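/- arXiv:1710.02727 — 2 statements merged into one kernel-verified Lean document; each statement's English description precedes it below -/
import Mathlib

section
/- Let 𝒢 be a minor-closed class of finite graphs of bounded treewidth and let t ≥ 1 be an integer. Then the following are equivalent: (i) there exists an integer C ≥ 1 such that every graph G ∈ 𝒢 admits an L-coloring with clustering C for every t-list assignment L; (ii) there exists an integer C ≥ 1 such that every non-empty graph in 𝒢 contains a t-island of size at most C. In other words, χ^l_⋆(𝒢) = col_⋆(𝒢). -/
open SimpleGraph

/-- `S` is a `t`-island in `G`: a nonempty set of vertices each of which has
fewer than `t` neighbors outside `S`. -/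
def IsIsland {V : Type*} (G : SimpleGraph V) (t : ℕ) (S : Set V) : Prop :=
  S.Nonempty ∧ ∀ v ∈ S, ((G.neighborSet v) \ S).ncard < t

/-- `H` is a minor of `G`: there is a model of `H` in `G`. -/
def IsMinorOf {W V : Type*} (H : SimpleGraph W) (G : SimpleGraph V) : Prop :=
  ∃ μ : W → Set V,
    (∀ w, (μ w).Nonempty) ∧
    (∀ w, (G.induce (μ w)).Connected) ∧
    (Pairwise fun w₁ w₂ => Disjoint (μ w₁) (μ w₂)) ∧
    (∀ ⦃w₁ w₂⦄, H.Adj w₁ w₂ → ∃ u ∈ μ w₁, ∃ v ∈ μ w₂, G.Adj u v)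

/-- The graph `I_n + P_m`: a path on `m` vertices together with `n` additional
pairwise non-adjacent vertices, each adjacent to every vertex of the path. -/
def IplusP (n m : ℕ) : SimpleGraph (Fin n ⊕ Fin m) :=
  SimpleGraph.fromRel (fun a b =>
    (∃ i j, a = Sum.inl i ∧ b = Sum.inr j) ∨
    (∃ i j : Fin m, a = Sum.inr i ∧ b = Sum.inr j ∧ (i : ℕ) + 1 = (j : ℕ)))

/-- `c` is a coloring of `G` with clustering `C`: every monochromatic connected
subgraph has at most `C` vertices. -/
def ClusteredColoring {V α : Type*} (G : SimpleGraph V) (C : ℕ) (c : V → α) : Prop :=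
  ∀ S : Set V, (G.induce S).Connected → (∀ u ∈ S, ∀ v ∈ S, c u = c v) → S.ncard ≤ C

/-- `G` has a tree decomposition of width at most `w`. -/
def HasTreewidthAtMost {V : Type*} (G : SimpleGraph V) (w : ℕ) : Prop :=
  ∃ (n : ℕ) (T : SimpleGraph (Fin n)) (β : Fin n → Set V), T.IsTree ∧
    (∀ ⦃u v⦄, G.Adj u v → ∃ x, u ∈ β x ∧ v ∈ β x) ∧
    (∀ v : V, (T.induce {x | v ∈ β x}).Connected) ∧
    (∀ x, (β x).ncard ≤ w + 1)

/-- A class of graphs, given for each `n` as a collection of graphs on `Fin n`. -/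
def MemClass (𝒢 : ∀ n : ℕ, SimpleGraph (Fin n) → Prop) {V : Type*} (G : SimpleGraph V) : Prop :=
  ∃ (n : ℕ) (G' : SimpleGraph (Fin n)), 𝒢 n G' ∧ Nonempty (G ≃g G')

/-- `𝒢` is a (proper) minor-closed class. -/
def MinorClosed (𝒢 : ∀ n : ℕ, SimpleGraph (Fin n) → Prop) : Prop :=
  (∃ (n : ℕ) (G : SimpleGraph (Fin n)), ¬ 𝒢 n G) ∧
  ∀ ⦃n k : ℕ⦄ (G : SimpleGraph (Fin n)) (H : SimpleGraph (Fin k)),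
    𝒢 n G → IsMinorOf H G → 𝒢 k H

/-- `𝒢` is closed under taking subgraphs (up to isomorphism). -/
def SubgraphClosed (𝒢 : ∀ n : ℕ, SimpleGraph (Fin n) → Prop) : Prop :=
  ∀ ⦃n k : ℕ⦄ (G : SimpleGraph (Fin n)) (H : SimpleGraph (Fin k)), 𝒢 n G →
    (∃ f : Fin k → Fin n, Function.Injective f ∧ ∀ ⦃a b⦄, H.Adj a b → G.Adj (f a) (f b)) →
    𝒢 k H

/-- The vertices that eventually become active in bootstrap `t`-percolation
starting from the active set `A`. -/
inductive PercolationActive {V : Type*} (G : SimpleGraph V) (t : ℕ) (A : Set V) : V → Prop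
  | base (v : V) : v ∈ A → PercolationActive G t A v
  | step (v : V) (N : Finset V) : t ≤ N.card → (∀ u ∈ N, G.Adj v u) →
      (∀ u ∈ N, PercolationActive G t A u) → PercolationActive G t A v

/-- The set `A` `t`-percolates in `G`. -/
def Percolates {V : Type*} (G : SimpleGraph V) (t : ℕ) (A : Set V) : Prop :=
  ∀ v, PercolationActive G t A v

/-- `G` contains `k` pairwise disjoint `t`-islands. -/
def HasDisjointIslands {V : Type*} (G : SimpleGraph V) (t k : ℕ) : Prop :=
  ∃ f : Fin k → Set V, (∀ i, IsIsland G t (f i)) ∧ Pairwise (Function.onFun Disjoint f)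

/-- `f` is significantly sublinear: `∑ f(⌈(3/2)^i⌉)/(3/2)^i` is finite. -/
def SignificantlySublinear (f : ℕ → ℕ) : Prop :=
  Summable (fun i : ℕ => (f ⌈((3:ℝ)/2)^i⌉₊ : ℝ) / ((3:ℝ)/2)^i)

/-- The class `𝒢` has `f`-separators. -/
def HasSeparators (f : ℕ → ℕ) (𝒢 : ∀ n : ℕ, SimpleGraph (Fin n) → Prop) : Prop :=
  ∀ (n : ℕ) (G : SimpleGraph (Fin n)), 𝒢 n G →
    ∃ L R : G.Subgraph, L ⊔ R = ⊤ ∧ (L.verts ∩ R.verts).ncard ≤ f n ∧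
      3 * (L.verts \ R.verts).ncard ≤ 2 * n ∧ 3 * (R.verts \ L.verts).ncard ≤ 2 * n

/-- The number of edges of `G` with at least one end in `A`. -/
noncomputable def edgesTouching {V : Type*} (G : SimpleGraph V) (A : Set V) : ℕ :=
  {e ∈ G.edgeSet | ∃ v ∈ A, v ∈ e}.ncard

section Connectivity

variable {V : Type*} {G : SimpleGraph V}

lemma SimpleGraph.Connected.exists_adj_of_mem_of_notMem {Q : Set V} (hQ : (G.induce Q).Connected)
    {P : Set V} {a b : V} (ha : a ∈ Q) (hb : b ∈ Q) (haP : a ∈ P) (hbP : b ∉ P) :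
    ∃ u ∈ Q, ∃ v ∈ Q, u ∈ P ∧ v ∉ P ∧ G.Adj u v := by
  obtain ⟨p⟩ := hQ.preconnected ⟨a, ha⟩ ⟨b, hb⟩
  obtain ⟨d, -, h1, h2⟩ := p.exists_boundary_dart {x | (x : V) ∈ P} haP hbP
  exact ⟨d.fst, d.fst.2, d.snd, d.snd.2, h1, h2, d.adj⟩

lemma SimpleGraph.connected_induce_singleton (v : V) : (G.induce {v}).Connected := by
  rw [SimpleGraph.induce_singleton_eq_top]
  exact SimpleGraph.connected_top

lemma SimpleGraph.Connected.induce_of_le {H : SimpleGraph V} (h : H ≤ G) {Q : Set V}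
    (hQ : (H.induce Q).Connected) : (G.induce Q).Connected :=
  hQ.mono fun _ _ hab => h hab

lemma SimpleGraph.connected_induce_union_of_adj {P Q : Set V} (hP : (G.induce P).Connected)
    (hQ : (G.induce Q).Connected) {u v : V} (hu : u ∈ P) (hv : v ∈ Q) (huv : G.Adj u v) :
    (G.induce (P ∪ Q)).Connected := by
  have h1 := induce_union_connected hP.preconnected
    (induce_pair_connected_of_adj huv).preconnected ⟨u, hu, by simp⟩
  have h2 := induce_union_connected h1.preconnected hQ.preconnected ⟨v, by simp, hv⟩
  have : P ∪ Q = P ∪ {u, v} ∪ Q := by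
    ext x
    simp only [Set.mem_union, Set.mem_insert_iff, Set.mem_singleton_iff]
    grind
  rwa [this]

lemma SimpleGraph.connected_induce_image_Icc {f : ℕ → V} {a b : ℕ} (hab : a ≤ b)
    (hf : ∀ i, a ≤ i → i < b → G.Adj (f i) (f (i + 1))) :
    (G.induce (f '' Set.Icc a b)).Connected := by
  induction b, hab using Nat.le_induction with
  | base =>
    rw [Set.Icc_self, Set.image_singleton]
    exact connected_induce_singleton (f a)
  | succ b hab ih =>
    have h := connected_induce_union_of_adj (ih fun i h1 h2 => hf i h1 (by omega))
      (connected_induce_singleton (f (b + 1))) (u := f b) (v := f (b + 1))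
      ⟨b, ⟨hab, le_rfl⟩, rfl⟩ rfl (hf b hab (by omega))
    rwa [← Set.image_singleton, ← Set.image_union,
      show Set.Icc a b ∪ {b + 1} = Set.Icc a (b + 1) by ext; simp; omega] at h

/-- A connected star: a center together with some of its neighbors. -/
lemma SimpleGraph.connected_induce_insert {c : V} {S : Set V} (hS : ∀ v ∈ S, G.Adj c v) :
    (G.induce (insert c S)).Connected := by
  have : Nonempty ↥(insert c S) := ⟨⟨c, by simp⟩⟩
  have key : ∀ v : ↥(insert c S), (G.induce (insert c S)).Reachable ⟨c, by simp⟩ v := by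
    rintro ⟨v, hv⟩
    rcases hv with rfl | hv
    · exact Reachable.refl _
    · exact Adj.reachable (hS v hv)
  exact ⟨fun u v => (key u).symm.trans (key v)⟩

/-- A connected set containing `a` and `b` contains the vertex set of a path from `a` to `b`. -/
lemma SimpleGraph.Connected.exists_path_in {Q : Set V} (hQ : (G.induce Q).Connected) {a b : V}
    (ha : a ∈ Q) (hb : b ∈ Q) :
    ∃ (m : ℕ) (f : ℕ → V), f 0 = a ∧ f m = b ∧ (∀ i ≤ m, f i ∈ Q) ∧
      Set.InjOn f (Set.Icc 0 m) ∧ ∀ i < m, G.Adj (f i) (f (i + 1)) := by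
  obtain ⟨p, hp⟩ := (hQ.preconnected ⟨a, ha⟩ ⟨b, hb⟩).exists_isPath
  refine ⟨p.length, fun i => p.getVert i, by simp, by simp, fun i _ => (p.getVert i).2, ?_,
    fun i hi => p.adj_getVert_succ hi⟩
  intro i hi j hj h
  exact hp.getVert_injOn hi.2 hj.2 (Subtype.ext h)

end Connectivity

section Separations

variable {V : Type*}

/-- The set of vertices outside `B` with a neighbor in `B`. -/
def outerBoundary (G : SimpleGraph V) (B : Set V) : Set V :=
  {u | u ∉ B ∧ ∃ v ∈ B, G.Adj v u}

/-- `W` separates `P` from `Q` in `G`, witnessed by a union `U` of components of `G - W`. -/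
def Separates (G : SimpleGraph V) (P Q W : Set V) : Prop :=
  ∃ U : Set V, Disjoint U W ∧ P ⊆ U ∪ W ∧ Disjoint U Q ∧ ∀ u ∈ U, ∀ v, G.Adj u v → v ∈ U ∪ W

lemma Separates.symm {G : SimpleGraph V} {P Q W : Set V} (h : Separates G P Q W) :
    Separates G Q P W := by
  obtain ⟨U, h1, h2, h3, h4⟩ := h
  refine ⟨(U ∪ W)ᶜ, ?_, ?_, ?_, ?_⟩
  · exact Set.disjoint_left.2 fun x hx hW => hx (Or.inr hW)
  · intro x _
    by_cases hW : x ∈ W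
    · exact Or.inr hW
    · exact Or.inl fun h => h.elim (fun h => Set.disjoint_left.1 h3 h ‹_›) hW
  · exact Set.disjoint_left.2 fun x hx hP => hx (h2 hP)
  · intro u hu v huv
    by_cases hW : v ∈ W
    · exact Or.inr hW
    · refine Or.inl fun h => h.elim (fun h => hu (h4 v h u huv.symm)) hW

/-- The part of `G` inside `U ∪ S` after the removal of the edge `xy`. -/
def sidePart (G : SimpleGraph V) (x y : V) (R : Set V) : SimpleGraph V where
  Adj u v := G.Adj u v ∧ s(u, v) ≠ s(x, y) ∧ u ∈ R ∧ v ∈ R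
  symm := ⟨fun u v h => ⟨h.1.symm, by rw [Sym2.eq_swap]; exact h.2.1, h.2.2.2, h.2.2.1⟩⟩
  loopless := ⟨fun u h => G.loopless.irrefl u h.1⟩

lemma sidePart_lt {G : SimpleGraph V} {x y : V} (hxy : G.Adj x y) (R : Set V) :
    sidePart G x y R < G :=
  lt_of_le_of_ne (fun _ _ h => h.1) fun h => by
    have : (sidePart G x y R).Adj x y := by rw [h]; exact hxy
    exact this.2.1 rfl

lemma subset_of_connected_sidePart {G : SimpleGraph V} {x y : V} {R Q : Set V}
    (hQ : ((sidePart G x y R).induce Q).Connected) {z : V} (hz : z ∈ Q) (hzR : z ∈ R) : Q ⊆ R := by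
  intro v hv
  by_contra hvR
  obtain ⟨u, -, w, -, -, h2, h3⟩ := hQ.exists_adj_of_mem_of_notMem hz hv hzR hvR
  exact h2 h3.2.2.2

/-- One side of a separation in `G - xy` inherits the connectivity of `G`. -/
lemma Separates.of_sidePart {G : SimpleGraph V} {x y : V} {P Q S U W : Set V}
    (hPU : P ⊆ U ∪ S) (hUQ : Disjoint U Q)
    (hU : ∀ u ∈ U, ∀ v, G.Adj u v → s(u, v) ≠ s(x, y) → v ∈ U ∪ S) (hy : y ∉ U ∪ S)
    (hW : Separates (sidePart G x y (U ∪ S)) P (insert x S) W) : Separates G P Q W := by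
  obtain ⟨D, h1, h2, h3, h4⟩ := hW
  have hDx : x ∉ D := fun h => Set.disjoint_left.1 h3 h (by simp)
  have hDS : ∀ z ∈ D, z ∉ S := fun z h h' => Set.disjoint_left.1 h3 h (by simp [h'])
  refine ⟨D ∩ U, h1.mono_left Set.inter_subset_left, ?_, hUQ.mono_left Set.inter_subset_right, ?_⟩
  · intro a ha
    rcases h2 ha with h | h
    · exact Or.inl ⟨h, (hPU ha).resolve_right (hDS a h)⟩
    · exact Or.inr h
  · rintro u ⟨huD, huU⟩ v huv
    have hne : s(u, v) ≠ s(x, y) := by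
      intro h
      rcases Sym2.eq_iff.1 h with ⟨rfl, -⟩ | ⟨rfl, -⟩
      · exact hDx huD
      · exact hy (Or.inl huU)
    have hv := hU u huU v huv hne
    rcases h4 u huD v ⟨huv, hne, Or.inl huU, hv⟩ with h | h
    · exact Or.inl ⟨h, hv.resolve_right (hDS v h)⟩
    · exact Or.inr h

/-- `P` and `Q` are joined by `k` disjoint connected sets. -/
def Linked (G : SimpleGraph V) (k : ℕ) (P Q : Set V) : Prop :=
  ∃ L : Fin k → Set V, (∀ i, (G.induce (L i)).Connected) ∧
    (Pairwise fun i j => Disjoint (L i) (L j)) ∧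
    (∀ i, (L i ∩ P).Nonempty) ∧ ∀ i, (L i ∩ Q).Nonempty

lemma Linked.mono {G H : SimpleGraph V} (h : H ≤ G) {k : ℕ} {P Q : Set V} (hL : Linked H k P Q) :
    Linked G k P Q := by
  obtain ⟨L, h1, h2⟩ := hL
  exact ⟨L, fun i => (h1 i).induce_of_le h, h2⟩

/-- Disjoint sets meeting a set of size at most `k` meet it in single vertices that exhaust it. -/
lemma exists_bijective_of_disjoint_meet [Finite V] {k : ℕ} {L : Fin k → Set V} {Y : Set V}
    (hd : Pairwise fun i j => Disjoint (L i) (L j)) (hY : Y.ncard ≤ k)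
    (hm : ∀ i, (L i ∩ Y).Nonempty) :
    ∃ a : Fin k → V, Function.Injective a ∧ Set.range a = Y ∧
      (∀ i, a i ∈ L i) ∧ ∀ i, ∀ v ∈ L i, v ∈ Y → v = a i := by
  choose a ha using hm
  have hinj : Function.Injective a := by
    intro i j h
    by_contra hij
    exact Set.disjoint_left.1 (hd hij) (ha i).1 (h ▸ (ha j).1)
  have hr : Set.range a = Y := by
    refine Set.eq_of_subset_of_ncard_le ?_ ?_ (Set.toFinite _)
    · rintro _ ⟨i, rfl⟩
      exact (ha i).2
    · rw [Set.ncard_range_of_injective hinj]; simpa using hY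
  refine ⟨a, hinj, hr, fun i => (ha i).1, fun i v hv hvY => ?_⟩
  rw [← hr] at hvY
  obtain ⟨j, rfl⟩ := hvY
  by_contra h
  have hij : i ≠ j := fun h' => h (h' ▸ rfl)
  exact Set.disjoint_left.1 (hd hij) hv (ha j).1

/-- Gluing two linkages along a separation of `G - xy`. -/
lemma Linked.glue [Finite V] {G : SimpleGraph V} {x y : V} (hxy : G.Adj x y) {k : ℕ}
    {P Q U S : Set V} (hx : x ∈ U) (hy : y ∉ U ∪ S) (hUS : Disjoint U S) (hS : S.ncard + 1 = k)
    (h1 : Linked (sidePart G x y (U ∪ S)) k P (insert x S))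
    (h2 : Linked (sidePart G x y Uᶜ) k (insert y S) Q) : Linked G k P Q := by
  obtain ⟨L, L1, L2, L3, L4⟩ := h1
  obtain ⟨M, M1, M2, M3, M4⟩ := h2
  have hxS : x ∉ S := Set.disjoint_left.1 hUS hx
  have hyS : y ∉ S := fun h => hy (Or.inr h)
  have hyU : y ∉ U := fun h => hy (Or.inl h)
  obtain ⟨a, ai, ar, aL, aU⟩ := exists_bijective_of_disjoint_meet L2
    ((Set.ncard_insert_of_notMem hxS).trans hS).le L4
  obtain ⟨b, bi, br, bM, bU⟩ := exists_bijective_of_disjoint_meet M2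
    ((Set.ncard_insert_of_notMem hyS).trans hS).le M3
  have haS : ∀ i, a i = x ∨ a i ∈ S := fun i => by
    have : a i ∈ insert x S := ar ▸ Set.mem_range_self i
    exact this
  have hbS : ∀ i, b i = y ∨ b i ∈ S := fun i => by
    have : b i ∈ insert y S := br ▸ Set.mem_range_self i
    exact this
  have hLsub : ∀ i, L i ⊆ U ∪ S := fun i => subset_of_connected_sidePart (L1 i) (aL i)
    ((haS i).elim (fun h => h ▸ Or.inl hx) Or.inr)
  have hMsub : ∀ i, M i ⊆ Uᶜ := fun i => subset_of_connected_sidePart (M1 i) (bM i)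
    ((hbS i).elim (fun h => h ▸ hyU) fun h h' => Set.disjoint_left.1 hUS h' h)
  have hex : ∀ i, ∃ j, (a i = x ∧ b j = y) ∨ (a i ∈ S ∧ b j = a i) := by
    intro i
    rcases haS i with h | h
    · obtain ⟨j, hj⟩ : y ∈ Set.range b := by rw [br]; simp
      exact ⟨j, Or.inl ⟨h, hj⟩⟩
    · obtain ⟨j, hj⟩ : a i ∈ Set.range b := by rw [br]; simp [h]
      exact ⟨j, Or.inr ⟨h, hj⟩⟩
  choose g hg using hex
  have hcross : ∀ i j, i ≠ j → Disjoint (L i) (M (g j)) := by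
    intro i j hij
    rw [Set.disjoint_left]
    intro v hv hv'
    have hvS : v ∈ S := (hLsub i hv).resolve_left (hMsub _ hv')
    have e1 := aU i v hv (Or.inr hvS)
    have e2 := bU _ v hv' (Or.inr hvS)
    rcases hg j with ⟨-, h⟩ | ⟨-, h⟩
    · exact hyS (h ▸ e2 ▸ hvS)
    · exact hij (ai (by rw [← e1, e2, h]))
  have ginj : Function.Injective g := by
    intro i j h
    apply ai
    rcases hg i with ⟨h1, h2⟩ | ⟨h1, h2⟩ <;> rcases hg j with ⟨h3, h4⟩ | ⟨h3, h4⟩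
    · rw [h1, h3]
    · rw [h] at h2; rw [h2] at h4; exact absurd (h4 ▸ h3) hyS
    · rw [h] at h2; rw [h4] at h2; exact absurd (h2 ▸ h1) hyS
    · rw [← h2, ← h4, h]
  refine ⟨fun i => L i ∪ M (g i), fun i => ?_, fun i j hij => ?_, fun i => ?_, fun i => ?_⟩
  · have c1 := (L1 i).induce_of_le (sidePart_lt hxy _).le
    have c2 := (M1 (g i)).induce_of_le (sidePart_lt hxy _).le
    rcases hg i with ⟨h1, h2⟩ | ⟨h1, h2⟩
    · exact connected_induce_union_of_adj c1 c2 (aL i) (bM (g i)) (by rw [h1, h2]; exact hxy)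
    · exact induce_union_connected c1.preconnected c2.preconnected
        ⟨a i, aL i, h2 ▸ bM (g i)⟩
  · simp only [Set.disjoint_union_left, Set.disjoint_union_right]
    exact ⟨⟨L2 hij, (hcross j i hij.symm).symm⟩, ⟨hcross i j hij, M2 (ginj.ne hij)⟩⟩
  · exact (L3 i).mono (Set.inter_subset_inter_left _ Set.subset_union_left)
  · exact (M4 (g i)).mono (Set.inter_subset_inter_left _ Set.subset_union_right)

/-- **Menger's theorem**: if no fewer than `k` vertices separate `P` from `Q`, there are
`k` disjoint connected sets joining `P` and `Q`. -/
theorem linked_of_forall_separates [Finite V] (G : SimpleGraph V) (k : ℕ) :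
    ∀ P Q : Set V, (∀ W, Separates G P Q W → k ≤ W.ncard) → Linked G k P Q := by
  induction G using WellFoundedLT.induction with
  | ind G ih =>
  intro P Q hsep
  by_cases hG : ∃ x y, G.Adj x y
  · obtain ⟨x, y, hxy⟩ := hG
    by_cases hdel : ∀ W, Separates (sidePart G x y Set.univ) P Q W → k ≤ W.ncard
    · exact (ih _ (sidePart_lt hxy _) P Q hdel).mono (sidePart_lt hxy _).le
    push Not at hdel
    obtain ⟨S, ⟨U, hUS, hPU, hUQ, hU⟩, hSk⟩ := hdel
    have hU' : ∀ u ∈ U, ∀ v, G.Adj u v → s(u, v) ≠ s(x, y) → v ∈ U ∪ S :=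
      fun u hu v huv hne => hU u hu v ⟨huv, hne, trivial, trivial⟩
    -- the edge `xy` joins the two sides of the separation
    have hends : (x ∈ U ∧ y ∉ U ∪ S) ∨ (y ∈ U ∧ x ∉ U ∪ S) := by
      by_contra hno
      push Not at hno
      refine absurd (hsep S ⟨U, hUS, hPU, hUQ, fun u hu v huv => ?_⟩) (by omega)
      by_cases hne : s(u, v) = s(x, y)
      · rcases Sym2.eq_iff.1 hne with ⟨rfl, rfl⟩ | ⟨rfl, rfl⟩
        · exact hno.1 hu
        · exact hno.2 hu
      · exact hU' u hu v huv hne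
    have main : ∀ x y, G.Adj x y → (∀ u ∈ U, ∀ v, G.Adj u v → s(u, v) ≠ s(x, y) → v ∈ U ∪ S) →
        x ∈ U → y ∉ U ∪ S → Linked G k P Q := by
      intro x y hxy hU' hx hy
      have hxS : x ∉ S := Set.disjoint_left.1 hUS hx
      have hk : S.ncard + 1 = k := by
        have := hsep (insert x S) ⟨U \ {x}, ?_, ?_, hUQ.mono_left Set.sdiff_subset, ?_⟩
        · rw [Set.ncard_insert_of_notMem hxS] at this
          omega
        · rw [Set.disjoint_left]
          rintro z ⟨hz, hzx⟩ (rfl | hz')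
          · exact hzx rfl
          · exact Set.disjoint_left.1 hUS hz hz'
        · intro z hz
          by_cases hzx : z = x
          · simp [hzx]
          · rcases hPU hz with h | h
            · exact Or.inl ⟨h, hzx⟩
            · exact Or.inr (Or.inr h)
        · rintro u ⟨hu, hux⟩ v huv
          have : v ∈ U ∪ S := hU' u hu v huv fun h => by
            rcases Sym2.eq_iff.1 h with ⟨rfl, -⟩ | ⟨rfl, -⟩
            · exact hux rfl
            · exact hy (Or.inl hu)
          by_cases hvx : v = x
          · simp [hvx]
          · rcases this with h | h
            · exact Or.inl ⟨h, hvx⟩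
            · exact Or.inr (Or.inr h)
      refine Linked.glue hxy hx hy hUS hk ?_ ?_
      · exact ih _ (sidePart_lt hxy _) _ _ fun W hW =>
          hsep W (Separates.of_sidePart hPU hUQ hU' hy hW)
      · have hc : (U ∪ S)ᶜ ∪ S = Uᶜ := by
          ext z
          have := fun h : z ∈ U => Set.disjoint_left.1 hUS h
          simp only [Set.mem_union, Set.mem_compl_iff]
          tauto
        have hsw : sidePart G y x ((U ∪ S)ᶜ ∪ S) = sidePart G x y Uᶜ := by
          ext u v
          simp only [sidePart, hc, Sym2.eq_swap (a := y)]
        refine ih _ (sidePart_lt hxy _) _ _ fun W hW => hsep W (Separates.symm ?_)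
        refine Separates.of_sidePart (x := y) (y := x) (U := (U ∪ S)ᶜ) (S := S) ?_ ?_ ?_ ?_ ?_
        · intro z hz
          rw [hc]
          exact fun h => Set.disjoint_left.1 hUQ h hz
        · exact Set.disjoint_left.2 fun z hz hP => hz (hPU hP)
        · intro u hu v huv hne
          rw [hc]
          refine fun hv => hu (hU' v hv u huv.symm ?_)
          rwa [Sym2.eq_swap, Sym2.eq_swap (a := x)]
        · rw [hc]; exact fun h => h hx
        · rw [hsw]; exact hW.symm
    rcases hends with ⟨h1, h2⟩ | ⟨h1, h2⟩
    · exact main x y hxy hU' h1 h2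
    · refine main y x hxy.symm ?_ h1 h2
      rwa [Sym2.eq_swap]
  · push Not at hG
    have hk := hsep (P ∩ Q) ⟨P \ Q, ?_, ?_, Set.disjoint_sdiff_left,
      fun u _ v h => absurd h (hG u v)⟩
    · have : Nonempty (Fin k ↪ ↥(P ∩ Q)) := by
        have := Fintype.ofFinite ↥(P ∩ Q)
        refine Function.Embedding.nonempty_of_card_le ?_
        rw [Fintype.card_fin, ← Nat.card_eq_fintype_card, Nat.card_coe_set_eq]
        exact hk
      obtain ⟨e⟩ := this
      refine ⟨fun i => {(e i : V)}, fun i => connected_induce_singleton _, fun i j hij => ?_,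
        fun i => ⟨e i, rfl, (e i).2.1⟩, fun i => ⟨e i, rfl, (e i).2.2⟩⟩
      simp only [Set.disjoint_singleton]
      exact fun h => hij (e.injective (Subtype.ext h))
    · exact Set.disjoint_left.2 fun z hz hz' => hz.2 hz'.2
    · intro z hz
      by_cases h : z ∈ Q
      · exact Or.inr ⟨hz, h⟩
      · exact Or.inl ⟨hz, h⟩

end Separations

section Chains

variable {V : Type*} {G : SimpleGraph V}

lemma outerBoundary_subset_union {A B : Set V} (h : A ⊆ B) :
    outerBoundary G A ⊆ B ∪ outerBoundary G B := by
  rintro u ⟨-, v, hv, huv⟩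
  by_cases hu : u ∈ B
  · exact Or.inl hu
  · exact Or.inr ⟨hu, v, h hv, huv⟩

lemma outerBoundary_inter_subset {A B C : Set V} (hAB : A ⊆ B) (hBC : B ⊆ C) :
    outerBoundary G A ∩ outerBoundary G C ⊆ outerBoundary G B := by
  rintro u ⟨hA, hC⟩
  exact (outerBoundary_subset_union hAB hA).resolve_left fun h => hC.1 (hBC h)

/-- A chain `B 0 ⊆ ⋯ ⊆ B (ℓ - 1)` of sets of size at most `D` with outer boundaries of size at
most `k`, in which consecutive sizes differ by more than `K`. -/
structure SeparationChain (G : SimpleGraph V) (K D k ℓ : ℕ) (B : ℕ → Set V) : Prop where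
  subset : ∀ i j : ℕ, i < j → j < ℓ → B i ⊆ B j
  gap : ∀ i j : ℕ, i < j → j < ℓ → (B i).ncard + K < (B j).ncard
  card_le : ∀ i < ℓ, (B i).ncard ≤ D
  boundary_le : ∀ i < ℓ, (outerBoundary G (B i)).ncard ≤ k

lemma SeparationChain.subset' {K D k ℓ : ℕ} {B : ℕ → Set V} (h : SeparationChain G K D k ℓ B)
    {i j : ℕ} (hij : i ≤ j) (hj : j < ℓ) : B i ⊆ B j := by
  rcases hij.eq_or_lt with rfl | hij
  · exact subset_rfl
  · exact h.subset i j hij hj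

lemma SeparationChain.comp {K D k ℓ N : ℕ} {B : ℕ → Set V} (h : SeparationChain G K D k ℓ B)
    {φ : ℕ → ℕ} (hφ : StrictMono φ) (hN : ∀ i < N, φ i < ℓ) :
    SeparationChain G K D k N (B ∘ φ) where
  subset _ j hij hj := h.subset _ _ (hφ hij) (hN j hj)
  gap _ j hij hj := h.gap _ _ (hφ hij) (hN j hj)
  card_le _ hi := h.card_le _ (hN _ hi)
  boundary_le _ hi := h.boundary_le _ (hN _ hi)

lemma mul_add_lt_pow_succ {N m a i : ℕ} (ha : a < N ^ m) (hi : i < N) :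
    a * N + i < N ^ (m + 1) := by
  have : (a + 1) * N ≤ N ^ m * N := Nat.mul_le_mul_right _ ha
  rw [pow_succ]
  nlinarith

/-- A long chain contains a subchain that cannot be separated by fewer vertices than the
bound on its boundaries. -/
lemma SeparationChain.exists_tight [Finite V] {K D N : ℕ} (hN : 1 ≤ N) :
    ∀ (k : ℕ) (B : ℕ → Set V), SeparationChain G K D k (N ^ (k + 1)) B →
      ∃ k' ≤ k, ∃ B', SeparationChain G K D k' N B' ∧
        ∀ X, B' 0 ⊆ X → X ⊆ B' (N - 1) → k' ≤ (outerBoundary G X).ncard := by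
  intro k
  induction k with
  | zero =>
    intro B hB
    exact ⟨0, le_rfl, B, by simpa using hB, fun _ _ _ => Nat.zero_le _⟩
  | succ k ih =>
    intro B hB
    by_cases hblock : ∃ a < N ^ (k + 1), ∀ X, B (a * N) ⊆ X → X ⊆ B (a * N + (N - 1)) →
        k + 1 ≤ (outerBoundary G X).ncard
    · obtain ⟨a, ha, hX⟩ := hblock
      refine ⟨k + 1, le_rfl, B ∘ fun i => a * N + i, hB.comp (fun i j h => by simpa using h)
        fun i hi => mul_add_lt_pow_succ ha hi, by simpa using hX⟩
    · push Not at hblock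
      choose! X h1 h2 h3 using hblock
      suffices hchain : SeparationChain G K D k (N ^ (k + 1)) X by
        obtain ⟨k', hk', h⟩ := ih X hchain
        exact ⟨k', by omega, h⟩
      have hlt : ∀ a b, a < b → a * N + (N - 1) < b * N := fun a b hab => by
        have : (a + 1) * N ≤ b * N := Nat.mul_le_mul_right _ hab
        rw [add_mul] at this
        omega
      have hb : ∀ a < N ^ (k + 1), ∀ i < N, a * N + i < N ^ (k + 1 + 1) :=
        fun a ha i hi => mul_add_lt_pow_succ ha hi
      refine ⟨fun a b hab hb' => ?_, fun a b hab hb' => ?_, fun a ha => ?_, fun a ha => ?_⟩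
      · exact (h2 a (by omega)).trans
          ((hB.subset _ _ (hlt a b hab) (by simpa using hb b hb' 0 hN)).trans (h1 b hb'))
      · have e1 := Set.ncard_le_ncard (h2 a (by omega))
        have e2 := Set.ncard_le_ncard (h1 b hb')
        have e3 := hB.gap _ _ (hlt a b hab) (by simpa using hb b hb' 0 hN)
        omega
      · exact (Set.ncard_le_ncard (h2 a ha)).trans (hB.card_le _ (hb a ha _ (by omega)))
      · exact Nat.le_of_lt_succ (h3 a ha)

/-- From a long sequence of sets in which every element occurs on an interval one may pick a
subsequence with constant pairwise intersections. -/
lemma exists_constant_intersections [Finite V] {N : ℕ} (hN : 1 ≤ N) :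
    ∀ (z : ℕ) (Y : ℕ → Set V),
      (∀ i j m, i ≤ j → j ≤ m → m < N ^ (z + 1) → Y i ∩ Y m ⊆ Y j) →
      (∀ i j, i < j → j < N ^ (z + 1) → (Y i ∩ Y j).ncard ≤ z) →
      ∃ φ : ℕ → ℕ, StrictMono φ ∧ (∀ i < N, φ i < N ^ (z + 1)) ∧
        ∃ Z, ∀ i j, i < j → j < N → Y (φ i) ∩ Y (φ j) = Z := by
  intro z
  induction z with
  | zero =>
    intro Y _ hY
    refine ⟨id, strictMono_id, by simp, ∅, fun i j hij hj => ?_⟩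
    have := hY i j hij (by simpa using hj)
    rwa [Nat.le_zero, Set.ncard_eq_zero] at this
  | succ z ih =>
    intro Y hinter hY
    have hb : ∀ a < N ^ (z + 1), ∀ i < N, a * N + i < N ^ (z + 1 + 1) :=
      fun a ha i hi => mul_add_lt_pow_succ ha hi
    by_cases hblock : ∃ a < N ^ (z + 1), z + 1 ≤ (Y (a * N) ∩ Y (a * N + (N - 1))).ncard
    · obtain ⟨a, ha, haz⟩ := hblock
      refine ⟨fun i => a * N + i, fun i j h => by simpa using h, hb a ha,
        Y (a * N) ∩ Y (a * N + (N - 1)), fun i j hij hj => ?_⟩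
      have hlast := hb a ha (N - 1) (by omega)
      refine (Set.eq_of_subset_of_ncard_le ?_ ?_ (Set.toFinite _)).symm
      all_goals dsimp only
      · exact Set.subset_inter (hinter _ _ _ (by omega) (by omega) hlast)
          (hinter _ _ _ (by omega) (by omega) hlast)
      · exact (hY _ _ (by omega) (hb a ha j hj)).trans haz
    · push Not at hblock
      have hle : ∀ a b, a < b → a * N + (N - 1) ≤ b * N := fun a b hab => by
        have : (a + 1) * N ≤ b * N := Nat.mul_le_mul_right _ hab
        rw [add_mul] at this
        omega
      have hb0 : ∀ a < N ^ (z + 1), a * N < N ^ (z + 1 + 1) := fun a ha => hb a ha 0 hN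
      obtain ⟨φ, h1, h2, Z, h3⟩ := ih (fun a => Y (a * N))
        (fun i j m hij hjm hm => hinter _ _ _ (Nat.mul_le_mul_right _ hij)
          (Nat.mul_le_mul_right _ hjm) (hb0 m hm))
        (fun a b hab hb' => by
          have hsub : Y (a * N) ∩ Y (b * N) ⊆ Y (a * N) ∩ Y (a * N + (N - 1)) :=
            Set.subset_inter Set.inter_subset_left
              (hinter _ _ _ (by omega) (hle a b hab) (hb0 b hb'))
          have := Set.ncard_le_ncard hsub
          have := hblock a (by omega)
          omega)
      exact ⟨fun i => φ i * N, fun i j hij => Nat.mul_lt_mul_of_pos_right (h1 hij) hN,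
        fun i hi => hb0 _ (h2 i hi), Z, h3⟩

/-- In a chain with constant intersections of boundaries and without small islands, some vertex
between two members of the chain has `t` neighbors in a single boundary. -/
lemma SeparationChain.exists_many_neighbors [Finite V] {K D k ℓ t : ℕ} {B : ℕ → Set V}
    (hB : SeparationChain G K D k ℓ B) (hkK : k ≤ K)
    (hisl : ∀ S, IsIsland G t S → D < S.ncard) {Z : Set V}
    (hZ : ∀ i j, i < j → j < ℓ → outerBoundary G (B i) ∩ outerBoundary G (B j) = Z)
    {i : ℕ} (hi : i + 3 < ℓ) :
    ∃ v ∈ B (i + 3), v ∉ B i ∧ ∃ e < ℓ, t ≤ (G.neighborSet v ∩ outerBoundary G (B e)).ncard := by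
  set Y : ℕ → Set V := fun e => outerBoundary G (B e) with hYdef
  have hnbr : ∀ e u v, v ∈ B e → G.Adj v u → u ∉ B e → u ∈ Y e := fun e u v hv h hu =>
    ⟨hu, v, hv, h⟩
  have hsub : ∀ a b, a ≤ b → b ≤ i + 3 → B a ⊆ B b := fun a b hab hb =>
    hB.subset' hab (by omega)
  set S : Set V := B (i + 3) \ (B i ∪ Y i) with hS
  have hSne : S.Nonempty := by
    rw [Set.nonempty_iff_ne_empty]
    intro h
    have h1 : B (i + 3) ⊆ B i ∪ Y i := Set.sdiff_eq_empty.1 h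
    have h2 := (Set.ncard_le_ncard h1).trans (Set.ncard_union_le _ _)
    have h3 := hB.gap i (i + 3) (by omega) hi
    have h4 := hB.boundary_le i (by omega)
    change (Y i).ncard ≤ k at h4
    omega
  have hnot : ¬ IsIsland G t S := fun h => by
    have h1 := hisl S h
    have h2 : S.ncard ≤ (B (i + 3)).ncard := Set.ncard_le_ncard Set.sdiff_subset
    have := hB.card_le (i + 3) hi
    omega
  obtain ⟨v, hvS, hv⟩ : ∃ v ∈ S, t ≤ ((G.neighborSet v) \ S).ncard := by
    by_contra hno
    push Not at hno
    exact hnot ⟨hSne, hno⟩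
  have hvB : v ∈ B (i + 3) := hvS.1
  have hvi : v ∉ B i := fun h => hvS.2 (Or.inl h)
  have hvY : v ∉ Y i := fun h => hvS.2 (Or.inr h)
  have hout : ∀ u ∈ G.neighborSet v \ S, u ∈ Y i ∨ u ∈ Y (i + 3) := by
    rintro u ⟨hvu, huS⟩
    by_cases hu : u ∈ B (i + 3)
    · by_contra hno
      push Not at hno
      refine huS ⟨hu, fun h => h.elim (fun h => ?_) hno.1⟩
      exact hvY (hnbr i v u h hvu.symm hvi)
    · exact Or.inr (hnbr _ u v hvB hvu hu)
  have hZi : Z ⊆ Y i := hZ i (i + 1) (by omega) (by omega) ▸ Set.inter_subset_left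
  have hZj : Z ⊆ Y (i + 3) := hZ i (i + 3) (by omega) (by omega) ▸ Set.inter_subset_right
  refine ⟨v, hvB, hvi, ?_⟩
  by_cases hv2 : v ∈ B (i + 2)
  · refine ⟨i, by omega, hv.trans (Set.ncard_le_ncard fun u hu => ⟨hu.1, ?_⟩)⟩
    refine (hout u hu).elim id fun h => hZi ?_
    rw [← hZ (i + 2) (i + 3) (by omega) hi]
    exact ⟨hnbr _ u v hv2 hu.1 fun h' => h.1 (hsub (i + 2) (i + 3) (by omega) le_rfl h'), h⟩
  · have hv1 : v ∉ B (i + 1) := fun h => hv2 (hsub (i + 1) (i + 2) (by omega) (by omega) h)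
    have hvY1 : v ∉ Y (i + 1) := fun h => by
      have h2 := (outerBoundary_subset_union (hsub (i + 1) (i + 2) (by omega) (by omega)) h
        ).resolve_left hv2
      refine hvY (hZi ?_)
      rw [← hZ (i + 1) (i + 2) (by omega) (by omega)]
      exact ⟨h, h2⟩
    refine ⟨i + 3, hi, hv.trans (Set.ncard_le_ncard fun u hu => ⟨hu.1, ?_⟩)⟩
    refine (hout u hu).elim (fun h => hZj ?_) id
    rw [← hZ i (i + 1) (by omega) (by omega)]
    refine ⟨h, (outerBoundary_subset_union (hsub i (i + 1) (by omega) (by omega)) h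
      ).resolve_left fun h' => hvY1 (hnbr _ v u h' hu.1.symm hv1)⟩

/-- If every set between `A` and `B` has at least `k` boundary vertices, then `k` disjoint
connected sets join the boundaries of `A` and `B`. -/
lemma linked_of_tight [Finite V] {A B : Set V} {k : ℕ} (hAB : A ⊆ B)
    (htight : ∀ X, A ⊆ X → X ⊆ B → k ≤ (outerBoundary G X).ncard) :
    Linked G k (outerBoundary G A) (outerBoundary G B) := by
  refine linked_of_forall_separates G k _ _ ?_
  rintro W ⟨U, hUW, hAU, hUB, hU⟩
  refine (htight (A ∪ (U ∩ B)) Set.subset_union_left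
    (Set.union_subset hAB Set.inter_subset_right)).trans (Set.ncard_le_ncard ?_)
  rintro u ⟨hu, v, hv, hvu⟩
  have key : u ∈ U ∪ W → u ∈ W := by
    rintro (h | h)
    · exfalso
      have huB : u ∉ B := fun h' => hu (Or.inr ⟨h, h'⟩)
      refine Set.disjoint_left.1 hUB h ⟨huB, v, ?_, hvu⟩
      exact hv.elim (fun h => hAB h) fun h => h.2
    · exact h
  rcases hv with hv | hv
  · exact key (hAU ⟨fun h => hu (Or.inl h), v, hv, hvu⟩)
  · exact key (hU v hv.1 u hvu)

/-- A connected set meeting the outer boundaries of a smaller and of a larger set meets every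
outer boundary in between. -/
lemma meets_outerBoundary_of_between {A B C Q : Set V} (hQ : (G.induce Q).Connected)
    (hAB : A ⊆ B) (hBC : B ⊆ C) (hA : (Q ∩ outerBoundary G A).Nonempty)
    (hC : (Q ∩ outerBoundary G C).Nonempty) : (Q ∩ outerBoundary G B).Nonempty := by
  obtain ⟨a, haQ, ha⟩ := hA
  obtain ⟨c, hcQ, hc⟩ := hC
  rcases outerBoundary_subset_union hAB ha with h | h
  · obtain ⟨u, -, v, hvQ, hu, hv, huv⟩ :=
      hQ.exists_adj_of_mem_of_notMem haQ hcQ h fun h' => hc.1 (hBC h')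
    exact ⟨v, hvQ, hv, u, hu, huv⟩
  · exact ⟨a, haQ, h⟩

end Chains

section TreeDecompositions

variable {V : Type*}

lemma SimpleGraph.Connected.exists_isPath_support_subset {G : SimpleGraph V} {Q : Set V}
    (hQ : (G.induce Q).Connected) {a b : V} (ha : a ∈ Q) (hb : b ∈ Q) :
    ∃ p : G.Walk a b, p.IsPath ∧ ∀ z ∈ p.support, z ∈ Q := by
  obtain ⟨p, hp⟩ := (hQ.preconnected ⟨a, ha⟩ ⟨b, hb⟩).exists_isPath
  refine ⟨p.map (Embedding.induce (G := G) Q).toHom,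
    hp.map (Embedding.induce (G := G) Q).injective, fun z hz => ?_⟩
  have hmap := Walk.support_map (Embedding.induce (G := G) Q).toHom p
  obtain ⟨y, -, rfl⟩ := List.mem_map.1 (hmap ▸ hz)
  exact y.2

/-- The node of a subtree `U` closest to `x` lies on every subtree joining `x` to `U`. -/
lemma SimpleGraph.IsTree.exists_gate {ι : Type*} {T : SimpleGraph ι} (hT : T.IsTree) {U : Set ι}
    (hU : (T.induce U).Connected) (x : ι) :
    ∃ g ∈ U, ∀ y ∈ U, ∀ Z : Set ι, (T.induce Z).Connected → x ∈ Z → y ∈ Z → g ∈ Z := by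
  classical
  obtain ⟨⟨u, hu⟩⟩ := hU.nonempty
  obtain ⟨g, hgU, hg⟩ : ∃ g ∈ U, ∀ z ∈ U, T.dist x g ≤ T.dist x z := by
    obtain ⟨g, hg, hmin⟩ := WellFounded.has_min (measure (T.dist x)).wf U ⟨u, hu⟩
    exact ⟨g, hg, fun z hz => not_lt.1 (hmin z hz)⟩
  refine ⟨g, hgU, fun y hy Z hZ hxZ hyZ => ?_⟩
  obtain ⟨p, hp⟩ := hT.connected.exists_walk_length_eq_dist x g
  have hpp : p.IsPath := p.isPath_of_length_eq_dist hp
  have hpU : ∀ z ∈ p.support, z ∈ U → z = g := by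
    intro z hz hzU
    by_contra hne
    have h1 := p.length_takeUntil_lt_length hz hne
    have h2 := T.dist_le (p.takeUntil z hz)
    have h3 := hg z hzU
    omega
  obtain ⟨q, hq, hqU⟩ := hU.exists_isPath_support_subset hgU hy
  obtain ⟨r, hr, hrZ⟩ := hZ.exists_isPath_support_subset hxZ hyZ
  have hpq : (p.append q).IsPath := by
    rw [Walk.isPath_def, Walk.support_append, List.nodup_append]
    refine ⟨hpp.support_nodup, hq.support_nodup.tail, fun a ha b hb hab => ?_⟩
    subst hab
    have hag := hpU a ha (hqU a (List.mem_of_mem_tail hb))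
    subst hag
    have := hq.support_nodup
    rw [← Walk.cons_tail_support] at this
    exact (List.nodup_cons.1 this).1 hb
  have heq : (⟨p.append q, hpq⟩ : T.Path x y) = ⟨r, hr⟩ :=
    (hT.isAcyclic.subsingleton_path x y).elim _ _
  have : p.append q = r := congrArg Subtype.val heq
  refine hrZ g ?_
  rw [← this, Walk.mem_support_append_iff]
  exact Or.inl p.end_mem_support

variable {G : SimpleGraph V} {ι : Type*} {T : SimpleGraph ι} {β : ι → Set V}

/-- The nodes whose bags meet a connected set form a subtree. -/
lemma connected_induce_nodes (hedge : ∀ ⦃u v⦄, G.Adj u v → ∃ x, u ∈ β x ∧ v ∈ β x)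
    (hconn : ∀ v : V, (T.induce {x | v ∈ β x}).Connected) {B : Set V}
    (hB : (G.induce B).Connected) : (T.induce {x | ∃ b ∈ B, b ∈ β x}).Connected := by
  set U : Set ι := {x | ∃ b ∈ B, b ∈ β x} with hUdef
  have hsub : ∀ b ∈ B, {x | b ∈ β x} ⊆ U := fun b hb x hx => ⟨b, hb, hx⟩
  have hone : ∀ b (hb : b ∈ B), ∀ x y (hx : b ∈ β x) (hy : b ∈ β y),
      (T.induce U).Reachable ⟨x, b, hb, hx⟩ ⟨y, b, hb, hy⟩ := fun b hb x y hx hy =>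
    ((hconn b).preconnected ⟨x, hx⟩ ⟨y, hy⟩).map (T.induceHomOfLE (hsub b hb)).toHom
  have hwalk : ∀ b b' : B, (G.induce B).Walk b b' → ∀ x y (hx : (b : V) ∈ β x)
      (hy : (b' : V) ∈ β y), (T.induce U).Reachable ⟨x, b, b.2, hx⟩ ⟨y, b', b'.2, hy⟩ := by
    intro b b' p
    induction p with
    | nil => exact fun x y hx hy => hone _ (Subtype.prop _) x y hx hy
    | cons h p ih =>
      intro x y hx hy
      obtain ⟨z, hz1, hz2⟩ := hedge h
      exact (hone _ (Subtype.prop _) x z hx hz1).trans (ih z y hz2 hy)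
  obtain ⟨b⟩ := hB.nonempty
  obtain ⟨x⟩ := (hconn b).nonempty
  have : Nonempty U := ⟨⟨x, b, b.2, x.2⟩⟩
  refine ⟨?_⟩
  rintro ⟨x, b, hb, hx⟩ ⟨y, b', hb', hy⟩
  obtain ⟨p⟩ := hB.preconnected ⟨b, hb⟩ ⟨b', hb'⟩
  exact hwalk _ _ p x y hx hy

/-- A large set whose outer boundary is contained in a bag contains a smaller, still reasonably
large set with that property. -/
lemma exists_ssubset_outerBoundary_subset_bag [Finite V] {w : ℕ} (hT : T.IsTree)
    (hedge : ∀ ⦃u v⦄, G.Adj u v → ∃ x, u ∈ β x ∧ v ∈ β x)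
    (hconn : ∀ v : V, (T.induce {x | v ∈ β x}).Connected)
    (hw : ∀ x, (β x).ncard ≤ w + 1) {M : ℕ} (hM : 1 ≤ M) {B : Set V} {x : ι}
    (hx : outerBoundary G B ⊆ β x) (hB : 2 * M + w < B.ncard) :
    ∃ B' ⊂ B, M ≤ B'.ncard ∧ ∃ x', outerBoundary G B' ⊆ β x' := by
  have hBne : B.Nonempty := by
    rw [← Set.ncard_pos]
    omega
  by_cases hBc : (G.induce B).Connected
  · obtain ⟨g, ⟨b, hb, hbg⟩, hgate⟩ := hT.exists_gate (connected_induce_nodes hedge hconn hBc) x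
    refine ⟨B \ β g, ⟨Set.sdiff_subset, fun h => (h hb).2 hbg⟩, ?_, g, ?_⟩
    · have := Set.ncard_le_ncard_sdiff_add_ncard B (β g)
      have := hw g
      omega
    · rintro u ⟨hu, v, ⟨hvB, hvg⟩, hvu⟩
      by_contra hug
      have huB : u ∉ B := fun h => hu ⟨h, hug⟩
      have hux : u ∈ β x := hx ⟨huB, v, hvB, hvu⟩
      obtain ⟨y, hy1, hy2⟩ := hedge hvu
      exact hug (hgate y ⟨v, hvB, hy1⟩ _ (hconn u) hux hy2)
  · obtain ⟨P, hPB, hPne, hPne', hP⟩ : ∃ P ⊆ B, P.Nonempty ∧ (B \ P).Nonempty ∧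
        ∀ u ∈ P, ∀ v ∈ B, G.Adj u v → v ∈ P := by
      have hne : Nonempty B := hBne.to_subtype
      have : ¬ (G.induce B).Preconnected := fun h => hBc ⟨h⟩
      unfold Preconnected at this
      push Not at this
      obtain ⟨u, v, huv⟩ := this
      refine ⟨{z | ∃ h : z ∈ B, (G.induce B).Reachable u ⟨z, h⟩}, fun z hz => hz.1,
        ⟨u, u.2, Reachable.refl _⟩, ⟨v, v.2, fun h => huv h.2⟩, ?_⟩
      rintro z ⟨hz, huz⟩ y hy hzy
      exact ⟨hy, huz.trans (Adj.reachable (show (G.induce B).Adj ⟨z, hz⟩ ⟨y, hy⟩ from hzy))⟩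
    by_cases hPM : M ≤ P.ncard
    · refine ⟨P, ⟨hPB, fun h => ?_⟩, hPM, x, ?_⟩
      · obtain ⟨z, hz, hz'⟩ := hPne'
        exact hz' (h hz)
      · rintro u ⟨hu, v, hv, hvu⟩
        exact hx ⟨fun h => hu (hP v hv u h hvu), v, hPB hv, hvu⟩
    · refine ⟨B \ P, ⟨Set.sdiff_subset, fun h => ?_⟩, ?_, x, ?_⟩
      · obtain ⟨z, hz⟩ := hPne
        exact (h (hPB hz)).2 hz
      · have := Set.ncard_le_ncard_sdiff_add_ncard B P
        omega
      · rintro u ⟨hu, v, hv, hvu⟩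
        refine hx ⟨fun h => hv.2 ?_, v, hv.1, hvu⟩
        exact hP u (not_not.1 fun h' => hu ⟨h, h'⟩) v hv.1 hvu.symm

lemma exists_subset_outerBoundary_subset_bag [Finite V] {w : ℕ} (hT : T.IsTree)
    (hedge : ∀ ⦃u v⦄, G.Adj u v → ∃ x, u ∈ β x ∧ v ∈ β x)
    (hconn : ∀ v : V, (T.induce {x | v ∈ β x}).Connected)
    (hw : ∀ x, (β x).ncard ≤ w + 1) {M : ℕ} (hM : 1 ≤ M) (B : Set V)
    (hx : ∃ x, outerBoundary G B ⊆ β x) (hB : M ≤ B.ncard) :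
    ∃ B' ⊆ B, M ≤ B'.ncard ∧ B'.ncard ≤ 2 * M + w ∧ ∃ x', outerBoundary G B' ⊆ β x' := by
  induction B using WellFoundedLT.induction with
  | ind B ih =>
  by_cases h : B.ncard ≤ 2 * M + w
  · exact ⟨B, subset_rfl, hB, h, hx⟩
  · obtain ⟨x, hx⟩ := hx
    obtain ⟨B', h1, h2, h3⟩ :=
      exists_ssubset_outerBoundary_subset_bag hT hedge hconn hw hM hx (not_le.1 h)
    obtain ⟨B'', h4, h5⟩ := ih B' h1 h3 h2
    exact ⟨B'', h4.trans h1.subset, h5⟩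

/-- The sizes of the members of a chain of separations along a tree decomposition of width `w`. -/
def chainSize (w : ℕ) : ℕ → ℕ
  | 0 => 1
  | i + 1 => 2 * chainSize w i + 2 * w + 2

lemma chainSize_mono (w : ℕ) : Monotone (chainSize w) :=
  monotone_nat_of_le_succ fun i => by rw [chainSize]; omega

lemma one_le_chainSize (w i : ℕ) : 1 ≤ chainSize w i :=
  chainSize_mono w (Nat.zero_le i)

/-- Large graphs of bounded treewidth contain long chains of separations. -/
lemma exists_separationChain [Finite V] {w : ℕ} (hG : HasTreewidthAtMost G w) {ℓ : ℕ}
    (hV : chainSize w ℓ ≤ Nat.card V) :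
    ∃ B, SeparationChain G (w + 1) (2 * chainSize w ℓ + w) (w + 1) ℓ B := by
  obtain ⟨n, T, β, hT, hedge, hconn, hw⟩ := hG
  have key : ∀ q : ℕ, ∀ B₀ : Set V, (∃ x, outerBoundary G B₀ ⊆ β x) → chainSize w q ≤ B₀.ncard →
      ∃ B : ℕ → Set V, (∀ i ≤ q, B i ⊆ B₀) ∧ (∀ i j : ℕ, i < j → j ≤ q → B i ⊆ B j) ∧
        ∀ i ≤ q, chainSize w i ≤ (B i).ncard ∧ (B i).ncard ≤ 2 * chainSize w i + w ∧
          ∃ x, outerBoundary G (B i) ⊆ β x := by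
    intro q
    induction q with
    | zero =>
      intro B₀ h1 h2
      obtain ⟨B', h3, h4⟩ := exists_subset_outerBoundary_subset_bag hT hedge hconn hw
        (one_le_chainSize w 0) B₀ h1 h2
      refine ⟨fun _ => B', fun _ _ => h3, fun _ _ _ _ => subset_rfl, fun i hi => ?_⟩
      obtain rfl : i = 0 := by omega
      exact h4
    | succ q ih =>
      intro B₀ h1 h2
      obtain ⟨B', h3, h4⟩ := exists_subset_outerBoundary_subset_bag hT hedge hconn hw
        (one_le_chainSize w (q + 1)) B₀ h1 h2
      obtain ⟨B, h5, h6, h7⟩ := ih B' h4.2.2 ((chainSize_mono w (Nat.le_succ q)).trans h4.1)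
      refine ⟨fun i => if i ≤ q then B i else B', fun i hi => ?_, fun i j hij hj => ?_,
        fun i hi => ?_⟩
      · dsimp only
        split_ifs with h
        · exact (h5 i h).trans h3
        · exact h3
      · dsimp only
        rw [if_pos (by omega : i ≤ q)]
        split_ifs with h
        · exact h6 i j hij h
        · exact h5 i (by omega)
      · dsimp only
        split_ifs with h
        · exact h7 i h
        · obtain rfl : i = q + 1 := by omega
          exact h4
  obtain ⟨x⟩ := hT.connected.nonempty
  obtain ⟨B, -, h1, h2⟩ := key ℓ Set.univ ⟨x, fun u hu => absurd (Set.mem_univ u) hu.1⟩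
    (by rwa [Set.ncard_univ])
  refine ⟨B, fun i j hij hj => h1 i j hij hj.le, fun i j hij hj => ?_, fun i hi => ?_,
    fun i hi => ?_⟩
  · have e1 := (h2 i (by omega)).2.1
    have e2 := (h2 j hj.le).1
    have e3 := chainSize_mono w (show i + 1 ≤ j from hij)
    rw [chainSize] at e3
    omega
  · have e1 := (h2 i hi.le).2.1
    have e3 := chainSize_mono w hi.le
    omega
  · obtain ⟨x, hx⟩ := (h2 i hi.le).2.2
    exact (Set.ncard_le_ncard hx).trans (hw x)

end TreeDecompositions

section HubbedPaths

/-- The disjoint union of paths on `p` vertices indexed by `E`, together with `r` pairwise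
non-adjacent hubs, each adjacent to every vertex of every path. -/
def hubbedPaths (r : ℕ) (E : Type*) (p : ℕ) : SimpleGraph (Fin r ⊕ (E × Fin p)) :=
  SimpleGraph.fromRel fun a b =>
    (∃ i x, a = Sum.inl i ∧ b = Sum.inr x) ∨
    (∃ (e : E) (i j : Fin p), a = Sum.inr (e, i) ∧ b = Sum.inr (e, j) ∧ (i : ℕ) + 1 = j)

lemma hubbedPaths_adj_hub {r p : ℕ} {E : Type*} (i : Fin r) (x : E × Fin p) :
    (hubbedPaths r E p).Adj (Sum.inl i) (Sum.inr x) := by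
  rw [hubbedPaths, SimpleGraph.fromRel_adj]
  exact ⟨Sum.inl_ne_inr, Or.inl (Or.inl ⟨i, x, rfl, rfl⟩)⟩

lemma hubbedPaths_adj_succ {r p : ℕ} {E : Type*} (e : E) {i j : Fin p} (h : (i : ℕ) + 1 = j) :
    (hubbedPaths r E p).Adj (Sum.inr (e, i)) (Sum.inr (e, j)) := by
  rw [hubbedPaths, SimpleGraph.fromRel_adj]
  refine ⟨fun h' => ?_, Or.inl (Or.inr ⟨e, i, j, rfl, rfl, h⟩)⟩
  simp only [Sum.inr.injEq, Prod.mk.injEq, true_and] at h'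
  subst h'
  omega

variable {V : Type*} {G : SimpleGraph V}

lemma isMinorOf_hubbedPaths {r p : ℕ} {E : Type*} (Q : Fin r → Set V) (M : E × Fin p → Set V)
    (hQ : ∀ i, (G.induce (Q i)).Connected) (hM : ∀ x, (G.induce (M x)).Connected)
    (hQQ : Pairwise fun i j => Disjoint (Q i) (Q j))
    (hMM : Pairwise fun x y => Disjoint (M x) (M y)) (hQM : ∀ i x, Disjoint (Q i) (M x))
    (hadj : ∀ i x, ∃ u ∈ Q i, ∃ v ∈ M x, G.Adj u v)
    (hsucc : ∀ (e : E) (i j : Fin p), (i : ℕ) + 1 = j →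
      ∃ u ∈ M (e, i), ∃ v ∈ M (e, j), G.Adj u v) :
    IsMinorOf (hubbedPaths r E p) G := by
  have hsymm : ∀ {A B : Set V}, (∃ u ∈ A, ∃ v ∈ B, G.Adj u v) → ∃ u ∈ B, ∃ v ∈ A, G.Adj u v :=
    fun ⟨u, hu, v, hv, h⟩ => ⟨v, hv, u, hu, h.symm⟩
  refine ⟨Sum.elim Q M, ?_, ?_, ?_, ?_⟩
  · rintro (i | x)
    · exact Set.nonempty_coe_sort.1 (hQ i).nonempty
    · exact Set.nonempty_coe_sort.1 (hM x).nonempty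
  · rintro (i | x)
    · exact hQ i
    · exact hM x
  · rintro (i | x) (j | y) h
    · exact hQQ fun h' => h (congrArg _ h')
    · exact hQM i y
    · exact (hQM j x).symm
    · exact hMM fun h' => h (congrArg _ h')
  · intro a b hab
    rw [hubbedPaths, SimpleGraph.fromRel_adj] at hab
    obtain ⟨-, (⟨i, x, rfl, rfl⟩ | ⟨e, i, j, rfl, rfl, h⟩) |
      (⟨i, x, rfl, rfl⟩ | ⟨e, i, j, rfl, rfl, h⟩)⟩ := hab
    · exact hadj i x
    · exact hsucc e i j h
    · exact hsymm (hadj i x)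
    · exact hsymm (hsucc e i j h)

/-- Many vertices outside of `r` disjoint connected sets that have neighbors in all of them yield
a complete bipartite minor. -/
lemma isMinorOf_hubbedPaths_one {k r : ℕ} {E : Type*} [Fintype E] (Q : Fin k → Set V)
    (hQ : ∀ l, (G.induce (Q l)).Connected) (hQQ : Pairwise fun l l' => Disjoint (Q l) (Q l'))
    {I : Finset (Fin k)} (hI : r ≤ I.card) (S : Finset V) (hS : Fintype.card E ≤ S.card)
    (hSQ : ∀ v ∈ S, ∀ l, v ∉ Q l) (hadj : ∀ v ∈ S, ∀ l ∈ I, ∃ u ∈ Q l, G.Adj v u) :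
    IsMinorOf (hubbedPaths r E 1) G := by
  obtain ⟨g⟩ : Nonempty (E ↪ S) := Function.Embedding.nonempty_of_card_le (by simpa using hS)
  have hmem := I.orderEmbOfCardLe_mem hI
  refine isMinorOf_hubbedPaths (fun i => Q (I.orderEmbOfCardLe hI i)) (fun x => {(g x.1 : V)})
    (fun i => hQ _) (fun x => connected_induce_singleton _)
    (fun i j hij => hQQ fun h => hij ((I.orderEmbOfCardLe hI).injective h)) ?_ ?_ ?_ ?_
  · rintro ⟨e, i⟩ ⟨e', i'⟩ h
    refine Set.disjoint_singleton.2 fun h' => h ?_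
    exact Prod.ext (g.injective (Subtype.ext h')) (Subsingleton.elim i i')
  · exact fun i x => Set.disjoint_singleton_right.2 (hSQ _ (g x.1).2 _)
  · intro i x
    obtain ⟨u, hu, h⟩ := hadj _ (g x.1).2 _ (hmem i)
    exact ⟨u, hu, _, rfl, h.symm⟩
  · intro e i j h
    omega

/-- Many vertices on one path that have neighbors in `r` other disjoint connected sets yield
long paths in a minor that are completely joined to `r` hubs. -/
lemma isMinorOf_hubbedPaths_of_path {k r p : ℕ} {E : Type*} [Fintype E] (Q : Fin k → Set V)
    (hQ : ∀ l, (G.induce (Q l)).Connected) (hQQ : Pairwise fun l l' => Disjoint (Q l) (Q l'))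
    {I : Finset (Fin k)} (hI : r ≤ I.card) {j : Fin k} (hj : j ∉ I) {f : ℕ → V} {n : ℕ}
    (hf : Set.InjOn f (Set.Icc 0 n)) (hpath : ∀ i < n, G.Adj (f i) (f (i + 1)))
    (hfj : ∀ i ≤ n, f i ∈ Q j) (S : Finset V) (hS : Fintype.card E * p < S.card)
    (hSf : ∀ v ∈ S, ∃ i ≤ n, f i = v) (hadj : ∀ v ∈ S, ∀ l ∈ I, ∃ u ∈ Q l, G.Adj v u) :
    IsMinorOf (hubbedPaths r E p) G := by
  classical
  set P : Finset ℕ := (Finset.range (n + 1)).filter fun i => f i ∈ S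
  have hPS : Fintype.card E * p + 1 ≤ P.card := by
    refine Nat.succ_le_of_lt (hS.trans_le ?_)
    refine (Finset.card_le_card (t := P.image f) fun v hv => ?_).trans Finset.card_image_le
    obtain ⟨i, hi, rfl⟩ := hSf v hv
    exact Finset.mem_image_of_mem _
      (Finset.mem_filter.2 ⟨Finset.mem_range.2 (Nat.lt_succ_of_le hi), hv⟩)
  set pos := P.orderEmbOfCardLe hPS
  have hposP : ∀ a, pos a ≤ n ∧ f (pos a) ∈ S := fun a => by
    have := Finset.mem_filter.1 (P.orderEmbOfCardLe_mem hPS a)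
    rw [Finset.mem_range] at this
    exact ⟨Nat.le_of_lt_succ this.1, this.2⟩
  have hlt : ∀ a : Fin (Fintype.card E * p), pos a.castSucc < pos a.succ := fun a =>
    pos.strictMono Fin.castSucc_lt_succ
  set idx : E × Fin p ≃ Fin (Fintype.card E * p) :=
    ((Fintype.equivFin E).prodCongr (Equiv.refl _)).trans finProdFinEquiv with hidx
  set M : E × Fin p → Set V := fun x =>
    f '' Set.Icc (pos (idx x).castSucc) (pos (idx x).succ - 1) with hMdef
  have hMQ : ∀ x, M x ⊆ Q j := by
    rintro x _ ⟨i, hi, rfl⟩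
    exact hfj i (hi.2.trans ((Nat.sub_le _ _).trans (hposP _).1))
  have hMMlt : ∀ x y, idx x < idx y → Disjoint (M x) (M y) := by
    intro x y hxy
    rw [Set.disjoint_left]
    rintro _ ⟨i, hi, rfl⟩ ⟨i', hi', h⟩
    have h1 := (hposP (idx x).succ).1
    have h2 := (hposP (idx y).succ).1
    have h3 := hlt (idx x)
    have h4 : pos (idx x).succ ≤ pos (idx y).castSucc := pos.monotone (by
      rw [Fin.le_def, Fin.val_succ, Fin.val_castSucc]; exact hxy)
    have := hf ⟨Nat.zero_le _, by have := hi'.2; omega⟩ ⟨Nat.zero_le _, by have := hi.2; omega⟩ h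
    have := hi.2
    have := hi'.1
    omega
  have hmem := I.orderEmbOfCardLe_mem hI
  have hfirst : ∀ x, f (pos (idx x).castSucc) ∈ M x := fun x =>
    ⟨_, ⟨le_rfl, by have := hlt (idx x); omega⟩, rfl⟩
  refine isMinorOf_hubbedPaths (fun i => Q (I.orderEmbOfCardLe hI i)) M
    (fun i => hQ _) (fun x => ?_)
    (fun i j hij => hQQ fun h => hij ((I.orderEmbOfCardLe hI).injective h)) ?_ ?_ ?_ ?_
  · have h1 := hlt (idx x)
    have h2 := (hposP (idx x).succ).1
    exact connected_induce_image_Icc (by omega) fun i _ hi => hpath i (by omega)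
  · intro x y hxy
    rcases lt_or_gt_of_ne (idx.injective.ne hxy) with h | h
    · exact hMMlt x y h
    · exact (hMMlt y x h).symm
  · intro i x
    refine Disjoint.mono_right (hMQ x) (hQQ ?_)
    rintro rfl
    exact hj (hmem i)
  · intro i x
    obtain ⟨u, hu, h⟩ := hadj _ (hposP (idx x).castSucc).2 _ (hmem i)
    exact ⟨u, hu, _, hfirst x, h.symm⟩
  · intro e a b hab
    have h1 := hlt (idx (e, a))
    have h2 := (hposP (idx (e, a)).succ).1
    have h3 : (idx (e, a)).succ = (idx (e, b)).castSucc := by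
      rw [Fin.ext_iff, Fin.val_succ, Fin.val_castSucc]
      simp only [hidx, Equiv.trans_apply, Equiv.prodCongr_apply, Prod.map_apply,
        Equiv.refl_apply, finProdFinEquiv_apply_val]
      omega
    refine ⟨_, ⟨pos (idx (e, a)).succ - 1, ⟨by omega, le_rfl⟩, rfl⟩, _, hfirst (e, b), ?_⟩
    rw [← h3]
    have := hpath (pos (idx (e, a)).succ - 1) (by omega)
    rwa [Nat.sub_add_cancel (by omega)] at this

/-- Many vertices with neighbors on at least `t` of `k` disjoint paths yield an obstruction. -/
lemma isMinorOf_hubbedPaths_of_paths {k m t : ℕ} {E : Type*} [Fintype E] (p : ℕ)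
    (f : Fin k → ℕ → V) (n : Fin k → ℕ) (hf : ∀ l, Set.InjOn (f l) (Set.Icc 0 (n l)))
    (hpath : ∀ l, ∀ i < n l, G.Adj (f l i) (f l (i + 1)))
    (hdisj : Pairwise fun l l' => Disjoint (f l '' Set.Icc 0 (n l)) (f l' '' Set.Icc 0 (n l')))
    (v : Fin m → V) (hv : Function.Injective v)
    (hvt : ∀ s, ∃ I : Finset (Fin k), t ≤ I.card ∧ ∀ l ∈ I, ∃ u ∈ f l '' Set.Icc 0 (n l),
      G.Adj (v s) u)
    (hm : 2 ^ k * (k + 1) * (Fintype.card E * (p + 1) + 1) ≤ m) :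
    IsMinorOf (hubbedPaths t E 1) G ∨ IsMinorOf (hubbedPaths (t - 1) E p) G := by
  classical
  set Q : Fin k → Set V := fun l => f l '' Set.Icc 0 (n l)
  have hQ : ∀ l, (G.induce (Q l)).Connected := fun l =>
    connected_induce_image_Icc (Nat.zero_le _) fun i _ hi => hpath l i hi
  choose I hIt hI using hvt
  have hjex : ∀ s, ∃ o : Option (Fin k),
      (o = none → ∀ l, v s ∉ Q l) ∧ ∀ j, o = some j → v s ∈ Q j := by
    intro s
    by_cases h : ∃ j, v s ∈ Q j
    · obtain ⟨j, hj⟩ := h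
      exact ⟨some j, by simp, by rintro _ ⟨⟩; exact hj⟩
    · push Not at h
      exact ⟨none, fun _ => h, by simp⟩
  choose o ho1 ho2 using hjex
  obtain ⟨⟨J, j⟩, hJj⟩ := Fintype.exists_le_card_fiber_of_mul_le_card (fun s => (I s, o s))
    (n := Fintype.card E * (p + 1) + 1) (by
      simpa [Fintype.card_prod, Fintype.card_finset, Fintype.card_option] using hm)
  set F := Finset.univ.filter fun s => (I s, o s) = (J, j)
  have hF : ∀ s ∈ F, I s = J ∧ o s = j := fun s hs => by
    simpa using (Finset.mem_filter.1 hs).2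
  set S := F.image v
  have hS : S.card = F.card := Finset.card_image_of_injective _ hv
  have hFpos : F.Nonempty := Finset.card_pos.1 (by omega)
  have hJt : t ≤ J.card := by
    obtain ⟨s, hs⟩ := hFpos
    rw [← (hF s hs).1]
    exact hIt s
  have hSJ : ∀ u ∈ S, ∀ l ∈ J, ∃ x ∈ Q l, G.Adj u x := by
    intro u hu l hl
    obtain ⟨s, hs, rfl⟩ := Finset.mem_image.1 hu
    rw [← (hF s hs).1] at hl
    exact hI s l hl
  have hcard : Fintype.card E ≤ Fintype.card E * (p + 1) := Nat.le_mul_of_pos_right _ (by omega)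
  have hcard' : Fintype.card E * p ≤ Fintype.card E * (p + 1) := Nat.mul_le_mul_left _ (by omega)
  rcases j with _ | j
  · refine Or.inl (isMinorOf_hubbedPaths_one Q hQ hdisj hJt S (by omega) ?_ hSJ)
    intro u hu l
    obtain ⟨s, hs, rfl⟩ := Finset.mem_image.1 hu
    exact ho1 s (hF s hs).2 l
  · refine Or.inr (isMinorOf_hubbedPaths_of_path Q hQ hdisj (I := J.erase j) ?_
      (Finset.notMem_erase j J) (hf j) (hpath j) (fun i hi => ⟨i, ⟨Nat.zero_le _, hi⟩, rfl⟩) S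
      (by omega) ?_ fun u hu l hl => hSJ u hu l (Finset.mem_of_mem_erase hl))
    · have := Finset.pred_card_le_card_erase (s := J) (a := j)
      omega
    · intro u hu
      obtain ⟨s, hs, rfl⟩ := Finset.mem_image.1 hu
      obtain ⟨i, hi, h⟩ := ho2 s j (hF s hs).2
      exact ⟨i, hi.2, h⟩

end HubbedPaths

section Obstructions

variable {V : Type*} {G : SimpleGraph V}

/-- A number of vertices with many neighbors on at most `w + 1` disjoint paths that forces an
obstruction whose paths have at most `M` vertices in total. -/
def attachmentBound (w M : ℕ) : ℕ := 2 ^ (w + 1) * (w + 1 + 1) * (M + 1)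

/-- The length of a chain of separations that forces an obstruction. -/
def chainLength (w M : ℕ) : ℕ :=
  ((3 * attachmentBound w M + 1) ^ (w + 1 + 1)) ^ (w + 1 + 1)

lemma SeparationChain.isMinorOf_hubbedPaths [Finite V] {w D t : ℕ} {E : Type*} [Fintype E]
    {p : ℕ} {B : ℕ → Set V}
    (hB : SeparationChain G (w + 1) D (w + 1) (chainLength w (Fintype.card E * (p + 1))) B)
    (hisl : ∀ S, IsIsland G t S → D < S.ncard) :
    IsMinorOf (hubbedPaths t E 1) G ∨ IsMinorOf (hubbedPaths (t - 1) E p) G := by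
  classical
  rw [chainLength] at hB
  set m := attachmentBound w (Fintype.card E * (p + 1)) with hm
  obtain ⟨k, hk, B₁, hB₁, htight⟩ := hB.exists_tight (Nat.one_le_pow _ _ (by omega)) (w + 1) B
  obtain ⟨φ, hφ, hφlt, Z, hZ⟩ := exists_constant_intersections (N := 3 * m + 1) (by omega) (w + 1)
    (fun e => outerBoundary G (B₁ e))
    (fun i j l hij hjl hl => outerBoundary_inter_subset (hB₁.subset' hij (by omega))
      (hB₁.subset' hjl hl))
    (fun i j hij hj => (Set.ncard_le_ncard Set.inter_subset_left).trans
      ((hB₁.boundary_le i (by omega)).trans hk))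
  have hB₂ := hB₁.comp hφ hφlt
  set B₂ := B₁ ∘ φ
  have hlink : Linked G k (outerBoundary G (B₂ 0)) (outerBoundary G (B₂ (3 * m))) := by
    refine linked_of_tight (hB₂.subset' (Nat.zero_le _) (by omega)) fun X h0 h1 => htight X ?_ ?_
    · exact (hB₁.subset' (Nat.zero_le _) (hφlt 0 (by omega))).trans h0
    · have := hφlt (3 * m) (by omega)
      exact h1.trans (hB₁.subset' (by omega) (by omega))
  obtain ⟨L, hLconn, hLdisj, hL0, hL1⟩ := hlink
  choose a haL ha using hL0
  choose b hbL hb using hL1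
  choose n f hf0 hfn hfL hfinj hfadj using fun l => (hLconn l).exists_path_in (haL l) (hbL l)
  set Q : Fin k → Set V := fun l => f l '' Set.Icc 0 (n l)
  have hQL : ∀ l, Q l ⊆ L l := by
    rintro l _ ⟨i, hi, rfl⟩
    exact hfL l i hi.2
  have hQdisj : Pairwise fun l l' => Disjoint (Q l) (Q l') := fun l l' h =>
    (hLdisj h).mono (hQL l) (hQL l')
  have hmeet : ∀ e < 3 * m + 1, ∀ l, (Q l ∩ outerBoundary G (B₂ e)).Nonempty := by
    intro e he l
    refine meets_outerBoundary_of_between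
      (connected_induce_image_Icc (Nat.zero_le _) fun i _ hi => hfadj l i hi)
      (hB₂.subset' (Nat.zero_le e) he) (hB₂.subset' (Nat.le_of_lt_succ he) (by omega)) ?_ ?_
    · exact ⟨a l, ⟨0, ⟨le_rfl, Nat.zero_le _⟩, hf0 l⟩, ha l⟩
    · exact ⟨b l, ⟨n l, ⟨Nat.zero_le _, le_rfl⟩, hfn l⟩, hb l⟩
  choose v hvB hvB' e he hvt using fun s : Fin m =>
    hB₂.exists_many_neighbors hk hisl hZ (i := 3 * s) (by omega)
  have hvne : ∀ s s', s < s' → v s ≠ v s' := by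
    intro s s' hss h
    refine hvB' s' (h ▸ hB₂.subset' ?_ (by omega) (hvB s))
    have : (s : ℕ) < s' := hss
    omega
  refine isMinorOf_hubbedPaths_of_paths p f n hfinj hfadj hQdisj v ?_ ?_ (m := m) ?_
  · intro s s' h
    by_contra hne
    rcases lt_or_gt_of_ne hne with h' | h'
    · exact hvne s s' h' h
    · exact hvne s' s h' h.symm
  · intro s
    obtain ⟨c, hcinj, hcrange, hcQ, -⟩ := exists_bijective_of_disjoint_meet hQdisj
      (hB₂.boundary_le (e s) (he s)) (hmeet (e s) (he s))
    refine ⟨Finset.univ.filter fun l => G.Adj (v s) (c l), (hvt s).trans ?_, fun l hl =>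
      ⟨c l, hcQ l, (Finset.mem_filter.1 hl).2⟩⟩
    rw [← Set.ncard_coe_finset, ← Set.ncard_image_of_injective _ hcinj]
    refine Set.ncard_le_ncard ?_
    rintro u ⟨hu, hu'⟩
    rw [← hcrange] at hu'
    obtain ⟨l, rfl⟩ := hu'
    exact ⟨l, by simpa using hu, rfl⟩
  · rw [hm, attachmentBound]
    gcongr
    omega

/-- A nonempty graph of bounded treewidth without small islands contains an obstruction. -/
lemma isMinorOf_hubbedPaths_of_forall_island [Finite V] [Nonempty V] {w t : ℕ} (ht : 1 ≤ t)
    (hG : HasTreewidthAtMost G w) (E : Type*) [Fintype E] (p : ℕ)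
    (hisl : ∀ S, IsIsland G t S →
      2 * chainSize w (chainLength w (Fintype.card E * (p + 1))) + w < S.ncard) :
    IsMinorOf (hubbedPaths t E 1) G ∨ IsMinorOf (hubbedPaths (t - 1) E p) G := by
  have huniv := hisl Set.univ ⟨Set.univ_nonempty, fun v _ => by
    rw [Set.sdiff_univ, Set.ncard_empty]
    exact ht⟩
  rw [Set.ncard_univ] at huniv
  obtain ⟨B, hB⟩ := exists_separationChain hG
    (ℓ := chainLength w (Fintype.card E * (p + 1))) (by omega)
  exact hB.isMinorOf_hubbedPaths hisl

end Obstructions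

section Colorings

variable {V W : Type*} {G : SimpleGraph V}

lemma IsMinorOf.trans_iso {U : Type*} {H : SimpleGraph W} {H' : SimpleGraph U}
    (h : IsMinorOf H G) (e : H' ≃g H) : IsMinorOf H' G := by
  obtain ⟨μ, h1, h2, h3, h4⟩ := h
  exact ⟨μ ∘ e, fun _ => h1 _, fun _ => h2 _, fun u v huv => h3 (e.injective.ne huv),
    fun u v huv => h4 (e.map_adj_iff.2 huv)⟩

/-- List colorability with bounded clustering for a minor-closed class on `Fin n`
yields it for minors on arbitrary finite vertex sets. -/
lemma exists_clusteredColoring_of_isMinorOf [Finite W] {𝒢 : ∀ n : ℕ, SimpleGraph (Fin n) → Prop}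
    (hmc : MinorClosed 𝒢) {t C : ℕ}
    (hC : ∀ (n : ℕ) (G : SimpleGraph (Fin n)), 𝒢 n G → ∀ L : Fin n → Finset ℕ,
      (∀ v, t ≤ (L v).card) → ∃ c : Fin n → ℕ, (∀ v, c v ∈ L v) ∧ ClusteredColoring G C c)
    {n : ℕ} {G : SimpleGraph (Fin n)} (hG : 𝒢 n G) {H : SimpleGraph W} (hH : IsMinorOf H G)
    (L : W → Finset ℕ) (hL : ∀ v, t ≤ (L v).card) :
    ∃ c : W → ℕ, (∀ v, c v ∈ L v) ∧ ClusteredColoring H C c := by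
  obtain ⟨k, ⟨e⟩⟩ := Finite.exists_equiv_fin W
  set e' : H.comap e.symm ≃g H := SimpleGraph.Iso.comap e.symm H
  obtain ⟨c, hcL, hc⟩ := hC k _ (hmc.2 G _ hG (hH.trans_iso e')) (L ∘ e.symm) fun v => hL _
  refine ⟨c ∘ e, fun v => by simpa using hcL (e v), fun S hS hSc => ?_⟩
  have hconn : ((H.comap e.symm).induce (e '' S)).Connected := by
    have hiso : H.induce S ≃g (H.comap e.symm).induce (e '' S) :=
      { toEquiv := e.image S
        map_rel_iff' := by
          intro a b
          simp }
    exact hiso.connected_iff.1 hS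
  have := hc (e '' S) hconn (by
    rintro _ ⟨u, hu, rfl⟩ _ ⟨v, hv, rfl⟩
    exact hSc u hu v hv)
  rwa [Set.ncard_image_of_injective _ e.injective] at this

/-- A list assignment for which `hubbedPaths` has no coloring with small clustering: the lists of
the hubs are disjoint, and the vertices of the path with index `(g, b)` see the color chosen by
`g` at every hub, together with an additional color if there are fewer than `t` hubs. -/
def hubbedPathsLists {r t : ℕ} (hr : r ≤ t) (C p : ℕ) :
    Fin r ⊕ (((Fin t → Fin t) × Fin (t * C + 1)) × Fin p) → Finset ℕ
  | Sum.inl i => Finset.univ.image fun a : Fin t => (i : ℕ) * t + a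
  | Sum.inr ((g, _), _) =>
    (Finset.univ.image fun i : Fin r => (i : ℕ) * t + g (i.castLE hr)) ∪
      if r < t then {t * t} else ∅

lemma mul_add_inj_of_lt {t i j a b : ℕ} (ha : a < t) (hb : b < t) (h : i * t + a = j * t + b) :
    i = j := by
  have h1 : (i * t + a) / t = i := by
    rw [mul_comm, Nat.mul_add_div (by omega), Nat.div_eq_of_lt ha, add_zero]
  have h2 : (j * t + b) / t = j := by
    rw [mul_comm, Nat.mul_add_div (by omega), Nat.div_eq_of_lt hb, add_zero]
  rw [← h1, ← h2, h]

lemma mul_add_lt_sq {r t i a : ℕ} (hr : r ≤ t) (hi : i < r) (ha : a < t) : i * t + a < t * t := by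
  have : (i + 1) * t ≤ t * t := Nat.mul_le_mul_right _ (by omega)
  rw [add_mul] at this
  omega

lemma le_card_hubbedPathsLists {r t C p : ℕ} (hr : r ≤ t) (hrt : t ≤ r + 1) (x) :
    t ≤ (hubbedPathsLists hr C p x).card := by
  rcases x with i | ⟨⟨g, b⟩, m⟩
  · rw [hubbedPathsLists, Finset.card_image_of_injective]
    · simp
    · intro a b h
      exact Fin.ext (by simpa using h)
  · have hcard : (Finset.univ.image fun i : Fin r => (i : ℕ) * t + g (i.castLE hr)).card = r := by
      rw [Finset.card_image_of_injective, Finset.card_univ, Fintype.card_fin]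
      exact fun i j h => Fin.ext (mul_add_inj_of_lt (g _).2 (g _).2 h)
    rw [hubbedPathsLists, Finset.card_union_of_disjoint, hcard]
    · split_ifs with h
      · rwa [Finset.card_singleton]
      · rw [Finset.card_empty]
        omega
    · rw [Finset.disjoint_left]
      intro y hy hyt
      obtain ⟨i, -, rfl⟩ := Finset.mem_image.1 hy
      split_ifs at hyt with h
      · have := mul_add_lt_sq hr i.2 (g (i.castLE hr)).2
        rw [Finset.mem_singleton] at hyt
        omega
      · simp at hyt

/-- The obstructions have no list coloring with clustering `C`. -/
lemma not_clusteredColoring_hubbedPaths {r t C p : ℕ} (hr : r ≤ t)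
    (hp : r < t → C < p) (hp0 : 0 < p)
    (c : Fin r ⊕ (((Fin t → Fin t) × Fin (t * C + 1)) × Fin p) → ℕ)
    (hc : ∀ x, c x ∈ hubbedPathsLists hr C p x) :
    ¬ ClusteredColoring (hubbedPaths r ((Fin t → Fin t) × Fin (t * C + 1)) p) C c := by
  classical
  intro hcl
  have hhub : ∀ i : Fin r, ∃ a : Fin t, c (Sum.inl i) = (i : ℕ) * t + a := fun i => by
    obtain ⟨a, -, h⟩ := Finset.mem_image.1 (hc (Sum.inl i))
    exact ⟨a, h.symm⟩
  choose g₀ hg₀ using hhub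
  set g : Fin t → Fin t := fun i => if h : (i : ℕ) < r then g₀ ⟨i, h⟩ else i with hgdef
  have hg : ∀ i : Fin r, c (Sum.inl i) = (i : ℕ) * t + g (i.castLE hr) := fun i => by
    rw [hg₀, hgdef]
    simp
  by_cases hblob : ∃ b, ∀ m i, c (Sum.inr ((g, b), m)) ≠ c (Sum.inl i)
  · obtain ⟨b, hb⟩ := hblob
    have hcol : ∀ m, r < t ∧ c (Sum.inr ((g, b), m)) = t * t := fun m => by
      rcases Finset.mem_union.1 (hc (Sum.inr ((g, b), m))) with h | h
      · obtain ⟨i, -, h⟩ := Finset.mem_image.1 h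
        exact absurd (h.symm.trans (hg i).symm) (hb m i)
      · split_ifs at h with hrt
        · exact ⟨hrt, Finset.mem_singleton.1 h⟩
        · simp at h
    have hrt := (hcol ⟨0, hp0⟩).1
    have hCp := hp hrt
    set f : ℕ → Fin r ⊕ (((Fin t → Fin t) × Fin (t * C + 1)) × Fin p) := fun i =>
      Sum.inr ((g, b), ⟨min i (p - 1), by omega⟩) with hf
    have h := hcl (f '' Set.Icc 0 (p - 1))
      (connected_induce_image_Icc (Nat.zero_le _) fun i _ hi => hubbedPaths_adj_succ _ (by
        dsimp only
        omega)) (by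
        rintro _ ⟨i, -, rfl⟩ _ ⟨j, -, rfl⟩
        rw [hf, (hcol _).2, (hcol _).2])
    rw [Set.InjOn.ncard_image, Set.ncard_eq_toFinset_card', Set.toFinset_Icc, Nat.card_Icc] at h
    · omega
    · intro i hi j hj hij
      simp only [hf, Sum.inr.injEq, Prod.mk.injEq, Fin.mk.injEq, true_and] at hij
      have := hi.2
      have := hj.2
      omega
  · push Not at hblob
    choose m i hmi using hblob
    obtain ⟨j, hj⟩ := Fintype.exists_lt_card_fiber_of_mul_lt_card i (n := C) (by
      simpa using Nat.lt_succ_of_le (Nat.mul_le_mul_right C hr))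
    set F := Finset.univ.filter fun b => i b = j
    set x : Fin (t * C + 1) → Fin r ⊕ (((Fin t → Fin t) × Fin (t * C + 1)) × Fin p) := fun b =>
      Sum.inr ((g, b), m b) with hx
    have hxinj : Function.Injective x := fun b b' h => by
      simp only [hx, Sum.inr.injEq, Prod.mk.injEq, true_and] at h
      exact h.1
    have hcx : ∀ y ∈ insert (Sum.inl j) (x '' F), c y = c (Sum.inl j) := by
      rintro y (rfl | ⟨b, hb, rfl⟩)
      · rfl
      · rw [hx, hmi, (Finset.mem_filter.1 hb).2]
    have h := hcl (insert (Sum.inl j) (x '' F)) (connected_induce_insert (by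
      rintro _ ⟨b, -, rfl⟩
      exact hubbedPaths_adj_hub _ _)) fun u hu v hv => (hcx u hu).trans (hcx v hv).symm
    have h' := (Set.ncard_le_ncard (Set.subset_insert (Sum.inl j) (x '' F))).trans h
    rw [Set.ncard_image_of_injective _ hxinj, Set.ncard_coe_finset] at h'
    omega

end Colorings

section Islands

lemma isMinorOf_induce {V W : Type*} (G : SimpleGraph V) {U : Set V} (e : W ≃ U) :
    IsMinorOf ((G.induce U).comap e) G := by
  refine ⟨fun x => {(e x : V)}, fun x => Set.singleton_nonempty _,
    fun x => connected_induce_singleton _, fun x y hxy => ?_, fun x y hxy => ?_⟩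
  · exact Set.disjoint_singleton.2 fun h => hxy (e.injective (Subtype.ext h))
  · exact ⟨_, rfl, _, rfl, hxy⟩

/-- If every nonempty member of a minor-closed class has a small island, then so does every
nonempty induced subgraph of a member. -/
lemma exists_island_subset {𝒢 : ∀ n : ℕ, SimpleGraph (Fin n) → Prop} (hmc : MinorClosed 𝒢)
    {t C : ℕ} (hC : ∀ (n : ℕ) (G : SimpleGraph (Fin n)), 𝒢 n G → 0 < n →
      ∃ S : Set (Fin n), IsIsland G t S ∧ S.ncard ≤ C)
    {n : ℕ} {G : SimpleGraph (Fin n)} (hG : 𝒢 n G) {U : Set (Fin n)} (hU : U.Nonempty) :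
    ∃ S ⊆ U, S.Nonempty ∧ S.ncard ≤ C ∧ ∀ v ∈ S, ((G.neighborSet v ∩ U) \ S).ncard < t := by
  obtain ⟨k, ⟨e⟩⟩ := Finite.exists_equiv_fin U
  have hk : 0 < k := by
    obtain ⟨u, hu⟩ := hU
    exact Fin.pos (e ⟨u, hu⟩)
  obtain ⟨S, ⟨hSne, hS⟩, hSC⟩ := hC k _ (hmc.2 G _ hG (isMinorOf_induce G e.symm)) hk
  have hinj : Function.Injective fun x => (e.symm x : Fin n) :=
    Subtype.val_injective.comp e.symm.injective
  refine ⟨(fun x => (e.symm x : Fin n)) '' S, ?_, hSne.image _, ?_, ?_⟩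
  · rintro _ ⟨x, -, rfl⟩
    exact (e.symm x).2
  · rwa [Set.ncard_image_of_injective _ hinj]
  · rintro _ ⟨x, hx, rfl⟩
    refine lt_of_le_of_lt ?_ (hS x hx)
    rw [← Set.ncard_image_of_injective _ hinj]
    refine Set.ncard_le_ncard ?_
    rintro u ⟨⟨hu, huU⟩, huS⟩
    refine ⟨e ⟨u, huU⟩, ⟨?_, fun h => huS ⟨_, h, by simp⟩⟩, by simp⟩
    change G.Adj (e.symm x) (e.symm (e ⟨u, huU⟩))
    simpa using hu

/-- Small islands in all induced subgraphs yield list colorings with small clustering. -/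
lemma exists_clusteredColoring_of_islands {V : Type*} [Finite V] {G : SimpleGraph V} {t C : ℕ}
    (hisl : ∀ U : Set V, U.Nonempty → ∃ S ⊆ U, S.Nonempty ∧ S.ncard ≤ C ∧
      ∀ v ∈ S, ((G.neighborSet v ∩ U) \ S).ncard < t)
    (ht : 1 ≤ t) (L : V → Finset ℕ) (hL : ∀ v, t ≤ (L v).card) :
    ∃ c : V → ℕ, (∀ v, c v ∈ L v) ∧ ClusteredColoring G C c := by
  classical
  suffices h : ∀ U : Set V, ∃ c : V → ℕ, (∀ v, c v ∈ L v) ∧ ∀ X ⊆ U, (G.induce X).Connected →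
      (∀ u ∈ X, ∀ v ∈ X, c u = c v) → X.ncard ≤ C by
    obtain ⟨c, h1, h2⟩ := h Set.univ
    exact ⟨c, h1, fun X => h2 X (Set.subset_univ X)⟩
  intro U
  induction U using WellFoundedLT.induction with
  | ind U ih =>
  rcases U.eq_empty_or_nonempty with rfl | hU
  · choose c hc using fun v => Finset.card_pos.1 (ht.trans (hL v))
    refine ⟨c, hc, fun X hX _ _ => ?_⟩
    rw [Set.subset_empty_iff.1 hX, Set.ncard_empty]
    exact Nat.zero_le C
  obtain ⟨S, hSU, hSne, hSC, hS⟩ := hisl U hU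
  obtain ⟨c, hcL, hc⟩ := ih (U \ S) ⟨Set.sdiff_subset, fun h => by
    obtain ⟨v, hv⟩ := hSne
    exact (h (hSU hv)).2 hv⟩
  have hfree : ∀ v, ∃ a ∈ L v, v ∈ S → ∀ u ∈ U, u ∉ S → G.Adj v u → c u ≠ a := by
    intro v
    by_cases hv : v ∈ S
    · have hlt : (c '' ((G.neighborSet v ∩ U) \ S)).ncard < (L v : Set ℕ).ncard := by
        rw [Set.ncard_coe_finset]
        exact (Set.ncard_image_le).trans_lt ((hS v hv).trans_le (hL v))
      obtain ⟨a, ha, ha'⟩ := Set.exists_mem_notMem_of_ncard_lt_ncard hlt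
      exact ⟨a, ha, fun _ u hu huS huv h => ha' ⟨u, ⟨⟨huv, hu⟩, huS⟩, h⟩⟩
    · obtain ⟨a, ha⟩ := Finset.card_pos.1 (ht.trans (hL v))
      exact ⟨a, ha, fun h => absurd h hv⟩
  choose a haL ha using hfree
  refine ⟨fun v => if v ∈ S then a v else c v, fun v => ?_, fun X hXU hX hmono => ?_⟩
  · dsimp only
    split_ifs
    · exact haL v
    · exact hcL v
  · beta_reduce at hmono
    by_cases hXS : X ⊆ S
    · exact (Set.ncard_le_ncard hXS).trans hSC
    obtain ⟨y, hyX, hyS⟩ := Set.not_subset.1 hXS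
    have hdisj : ∀ x ∈ X, x ∉ S := by
      intro x hx hxS
      obtain ⟨u, huX, v, hvX, hu, hv, huv⟩ := hX.exists_adj_of_mem_of_notMem hx hyX hxS hyS
      have := hmono u huX v hvX
      rw [if_pos hu, if_neg hv] at this
      exact ha u hu v (hXU hvX) hv huv this.symm
    refine hc X (fun x hx => ⟨hXU hx, hdisj x hx⟩) hX fun u hu v hv => ?_
    have := hmono u hu v hv
    rwa [if_neg (hdisj u hu), if_neg (hdisj v hv)] at this

end Islands

/-- for a minor-closed class `𝒢` of bounded treewidth, `𝒢` has uniformly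
bounded clustered list colorings with `t` colors iff every non-empty member of `𝒢`
contains a `t`-island of uniformly bounded size; i.e. `χ^l_⋆(𝒢) = col_⋆(𝒢)`. -/
theorem stmt5 (𝒢 : ∀ n : ℕ, SimpleGraph (Fin n) → Prop) (hmc : MinorClosed 𝒢)
    (w : ℕ) (htw : ∀ (n : ℕ) (G : SimpleGraph (Fin n)), 𝒢 n G → HasTreewidthAtMost G w)
    (t : ℕ) (ht : 1 ≤ t) :
    (∃ C : ℕ, 1 ≤ C ∧ ∀ (n : ℕ) (G : SimpleGraph (Fin n)), 𝒢 n G →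
        ∀ L : Fin n → Finset ℕ, (∀ v, t ≤ (L v).card) →
          ∃ c : Fin n → ℕ, (∀ v, c v ∈ L v) ∧ ClusteredColoring G C c) ↔
    (∃ C : ℕ, 1 ≤ C ∧ ∀ (n : ℕ) (G : SimpleGraph (Fin n)), 𝒢 n G → 0 < n →
        ∃ S : Set (Fin n), IsIsland G t S ∧ S.ncard ≤ C) := by
  constructor
  · rintro ⟨C, -, hC⟩
    set E := (Fin t → Fin t) × Fin (t * C + 1)
    refine ⟨2 * chainSize w (chainLength w (Fintype.card E * (C + 1 + 1))) + w,
      by have := one_le_chainSize w (chainLength w (Fintype.card E * (C + 1 + 1))); omega,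
      fun n G hG hn => ?_⟩
    by_contra hno
    push Not at hno
    have : Nonempty (Fin n) := ⟨⟨0, hn⟩⟩
    have hcol : ∀ (r p : ℕ), r ≤ t → t ≤ r + 1 → (r < t → C < p) → 0 < p →
        ¬ IsMinorOf (hubbedPaths r E p) G := fun r p hr hrt hp hp0 h => by
      obtain ⟨c, hcL, hc⟩ := exists_clusteredColoring_of_isMinorOf hmc hC hG h
        (hubbedPathsLists hr C p) (le_card_hubbedPathsLists hr hrt)
      exact not_clusteredColoring_hubbedPaths hr hp hp0 c hcL hc
    rcases isMinorOf_hubbedPaths_of_forall_island ht (htw n G hG) E (C + 1) hno with h | h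
    · exact hcol t 1 le_rfl (by omega) (fun h => absurd h (lt_irrefl t)) one_pos h
    · exact hcol (t - 1) (C + 1) (by omega) (by omega) (fun _ => C.lt_succ_self) C.succ_pos h
  · rintro ⟨C, hC1, hC⟩
    exact ⟨C, hC1, fun n G hG L hL => exists_clusteredColoring_of_islands
      (fun U hU => exists_island_subset hmc hC hG hU) ht L hL⟩
end

section
/- For every integer t ≥ 1 there exists an integer C ≥ 1 such that every finite graph with no K_{t+1} minor admits a 2t-coloring with clustering C. -/
open SimpleGraph

/-- Some edge of `G` joins a vertex of `X` to a vertex of `Y`. -/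
def Touches {V : Type*} (G : SimpleGraph V) (X Y : Set V) : Prop :=
  ∃ x ∈ X, ∃ y ∈ Y, G.Adj x y

lemma Touches.mono {V : Type*} {G : SimpleGraph V} {X Y X' Y' : Set V} (h : Touches G X Y)
    (hX : X ⊆ X') (hY : Y ⊆ Y') : Touches G X' Y' := by
  obtain ⟨x, hx, y, hy, hxy⟩ := h
  exact ⟨x, hX hx, y, hY hy, hxy⟩

lemma Touches.symm {V : Type*} {G : SimpleGraph V} {X Y : Set V} (h : Touches G X Y) :
    Touches G Y X := by
  obtain ⟨x, hx, y, hy, hxy⟩ := h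
  exact ⟨y, hy, x, hx, hxy.symm⟩

/-- The sets `A i` that touch `D` are connected, disjoint from `D`, pairwise disjoint, and
pairwise touching. -/
def IsCliqueAround {V ι : Type*} (G : SimpleGraph V) (A : ι → Set V) (D : Set V) : Prop :=
  ∀ i, Touches G (A i) D → (G.induce (A i)).Connected ∧ Disjoint (A i) D ∧
    ∀ j, j ≠ i → Touches G (A j) D → Disjoint (A i) (A j) ∧ Touches G (A i) (A j)

/-- `D` has a coloring by pairs with clustering `C` in which no vertex adjacent to `A i` has first
color `i`. -/
def HasColoringAvoiding {V ι : Type*} (G : SimpleGraph V) (C : ℕ) (A : ι → Set V) (D : Set V) :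
    Prop :=
  ∃ f : V → ι × Bool, (∀ v ∈ D, ∀ i, (∃ u ∈ A i, G.Adj u v) → (f v).1 ≠ i) ∧
    ∀ S ⊆ D, (G.induce S).Connected → (∀ u ∈ S, ∀ v ∈ S, f u = f v) → S.ncard ≤ C

lemma SimpleGraph.Preconnected.eq_of_forall_adj {V α : Type*} {G : SimpleGraph V}
    (hG : G.Preconnected) (g : V → α) (h : ∀ x y, G.Adj x y → g x = g y) (x y : V) :
    g x = g y := by
  obtain ⟨p⟩ := hG x y
  induction p with
  | nil => rfl
  | cons hxy _ ih => exact (h _ _ hxy).trans ih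

lemma eq_of_induce_preconnected {V α : Type*} {G : SimpleGraph V} {S : Set V}
    (hS : (G.induce S).Preconnected) (g : V → α)
    (h : ∀ x ∈ S, ∀ y ∈ S, G.Adj x y → g x = g y) {x y : V} (hx : x ∈ S) (hy : y ∈ S) :
    g x = g y :=
  hS.eq_of_forall_adj (fun z => g z) (fun a b hab => h a a.2 b b.2 hab) ⟨x, hx⟩ ⟨y, hy⟩

lemma SimpleGraph.Walk.eq_getVert_dist_of_mem_support {V : Type*} {G : SimpleGraph V} {r v x : V}
    (p : G.Walk r v) (hp : p.length = G.dist r v) (hx : x ∈ p.support) :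
    x = p.getVert (G.dist r x) := by
  classical
  have h := length_eq_dist_of_subwalk hp (p.isSubwalk_takeUntil hx)
  rw [← h, p.getVert_length_takeUntil hx]

/-- A union of geodesics from a common root to `v i`, 2-colored by the parity of the distance to
the root. -/
lemma exists_connected_two_coloring {V ι : Type*} [Fintype ι] [Nonempty ι] {G : SimpleGraph V}
    {D : Set V} (hD : (G.induce D).Connected) (v : ι → V) (hv : ∀ i, v i ∈ D) :
    ∃ H ⊆ D, (∀ i, v i ∈ H) ∧ (G.induce H).Connected ∧ ∃ b : V → Bool,
      ∀ S ⊆ H, (G.induce S).Connected → (∀ x ∈ S, ∀ y ∈ S, b x = b y) →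
        S.ncard ≤ Fintype.card ι := by
  classical
  obtain ⟨r⟩ := hD.nonempty
  choose p hp using fun i => hD.exists_walk_length_eq_dist r ⟨v i, hv i⟩
  let q (i : ι) : G.Walk r (v i) := (p i).map (Embedding.induce D).toHom
  have hq (i : ι) (x : V) : x ∈ (q i).support ↔ ∃ h : x ∈ D, ⟨x, h⟩ ∈ (p i).support := by
    have h : (q i).support = (p i).support.map Subtype.val := Walk.support_map _ _
    simp [h]
  let H : Set V := {x | ∃ i, x ∈ (q i).support}
  have hHD : H ⊆ D := by
    rintro x ⟨i, hi⟩
    exact ((hq i x).1 hi).1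
  let d (x : V) : ℕ := if h : x ∈ D then (G.induce D).dist r ⟨x, h⟩ else 0
  have hd (x : V) (h : x ∈ D) : d x = (G.induce D).dist r ⟨x, h⟩ := dif_pos h
  refine ⟨H, hHD, fun i => ⟨i, (q i).end_mem_support⟩, ?_, fun x => decide (Even (d x)), ?_⟩
  · refine induce_connected_of_patches (r : V) ⟨Classical.arbitrary ι, Walk.start_mem_support _⟩ ?_
    rintro x ⟨i, hi⟩
    exact ⟨{y | y ∈ (q i).support}, fun y hy => ⟨i, hy⟩, Walk.start_mem_support _, hi,
      (q i).connected_induce_support.preconnected _ _⟩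
  · intro S hSH hS hb
    obtain ⟨s⟩ := hS.nonempty
    have hconst : ∀ x ∈ S, d x = d s := by
      intro x hx
      refine eq_of_induce_preconnected hS.preconnected d ?_ hx s.2
      intro y hy z hz hyz
      have hyD := hHD (hSH hy)
      have hzD := hHD (hSH hz)
      have hadj : (G.induce D).Adj ⟨y, hyD⟩ ⟨z, hzD⟩ := hyz
      have h1 := hadj.diff_dist_adj (u := r)
      rw [← hd, ← hd] at h1
      have h2 := hb y hy z hz
      simp only [decide_eq_decide] at h2
      grind
    have hsub : S ⊆ Set.range fun i => ((p i).getVert (d s) : V) := by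
      intro x hx
      obtain ⟨i, hi⟩ := hSH hx
      obtain ⟨hxD, hxp⟩ := (hq i x).1 hi
      refine ⟨i, ?_⟩
      have h := (p i).eq_getVert_dist_of_mem_support (hp i) hxp
      rw [← hd, hconst x hx] at h
      exact (congrArg Subtype.val h).symm
    calc S.ncard ≤ (Set.range fun i => ((p i).getVert (d s) : V)).ncard :=
          Set.ncard_le_ncard hsub (Set.finite_range _)
      _ ≤ Fintype.card ι := by
          rw [← Set.image_univ, ← Nat.card_eq_fintype_card, ← Set.ncard_univ]
          exact Set.ncard_image_le

/-- Colorings of the connected components of `D` combine to a coloring of `D`. -/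
lemma HasColoringAvoiding.of_connected {V ι : Type*} [Nonempty ι] {G : SimpleGraph V} {C : ℕ}
    {A : ι → Set V} {D : Set V}
    (h : ∀ K ⊆ D, (G.induce K).Connected → HasColoringAvoiding G C A K) :
    HasColoringAvoiding G C A D := by
  classical
  have hK (c : (G.induce D).ConnectedComponent) :
      HasColoringAvoiding G C A (Subtype.val '' c.supp) := by
    refine h _ (by rintro _ ⟨x, _, rfl⟩; exact x.2) ?_
    have hc : ((G.induce D).induce c.supp).Connected := c.connected_toSimpleGraph
    let φ : (G.induce D).induce c.supp →g G.induce (Subtype.val '' c.supp) :=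
      ⟨fun x => ⟨x.1.1, x.1, x.2, rfl⟩, fun hab => hab⟩
    refine hc.map φ ?_
    rintro ⟨_, x, hx, rfl⟩
    exact ⟨⟨x, hx⟩, rfl⟩
  choose F hF₁ hF₂ using hK
  let comp (x : V) (hx : x ∈ D) := (G.induce D).connectedComponentMk ⟨x, hx⟩
  let f (x : V) : ι × Bool :=
    if hx : x ∈ D then F (comp x hx) x else (Classical.arbitrary ι, true)
  have hf (x : V) (hx : x ∈ D) : f x = F (comp x hx) x := dif_pos hx
  have hmem (x : V) (hx : x ∈ D) : x ∈ Subtype.val '' (comp x hx).supp := ⟨⟨x, hx⟩, rfl, rfl⟩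
  refine ⟨f, ?_, ?_⟩
  · intro v hv i hi
    rw [hf v hv]
    exact hF₁ _ v (hmem v hv) i hi
  · intro S hSD hS hmono
    obtain ⟨s⟩ := hS.nonempty
    have hcomp (x : V) (hx : x ∈ S) : comp x (hSD hx) = comp s (hSD s.2) :=
      hS.preconnected.eq_of_forall_adj (fun z => comp z (hSD z.2))
        (fun a b hab => ConnectedComponent.connectedComponentMk_eq_of_adj hab) ⟨x, hx⟩ s
    refine hF₂ (comp s (hSD s.2)) S ?_ hS ?_
    · intro x hx
      rw [← hcomp x hx]
      exact hmem x _
    · intro x hx y hy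
      have := hmono x hx y hy
      rwa [hf x (hSD hx), hf y (hSD hy), hcomp x hx, hcomp y hy] at this

lemma IsCliqueAround.exists_not_touches {V : Type*} {G : SimpleGraph V} {t : ℕ}
    {A : Fin t → Set V} {D : Set V} (hA : IsCliqueAround G A D) (hD : (G.induce D).Connected)
    (hG : ¬ IsMinorOf (⊤ : SimpleGraph (Fin (t + 1))) G) : ∃ c, ¬ Touches G (A c) D := by
  by_contra! hall
  let μ : Fin (t + 1) → Set V := Fin.cons D A
  have hconn (w : Fin (t + 1)) : (G.induce (μ w)).Connected := by
    refine Fin.cases ?_ (fun i => ?_) w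
    · exact hD
    · exact (hA i (hall i)).1
  refine hG ⟨μ, fun w => Set.nonempty_coe_sort.1 (hconn w).nonempty, hconn, ?_, ?_⟩
  · intro a b
    refine Fin.cases ?_ (fun i => ?_) a <;> refine Fin.cases ?_ (fun j => ?_) b <;> intro hab
    · exact absurd rfl hab
    · exact (hA j (hall j)).2.1.symm
    · exact (hA i (hall i)).2.1
    · exact ((hA i (hall i)).2.2 j (fun h => hab (by rw [h])) (hall j)).1
  · intro a b
    refine Fin.cases ?_ (fun i => ?_) a <;> refine Fin.cases ?_ (fun j => ?_) b <;> intro hab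
    · exact absurd rfl hab.ne
    · exact (hall j).symm
    · exact hall i
    · exact ((hA i (hall i)).2.2 j (fun h => hab.ne (by rw [h])) (hall j)).2

lemma IsCliqueAround.update {V ι : Type*} [DecidableEq ι] {G : SimpleGraph V} {A : ι → Set V}
    {D H K : Set V} (hA : IsCliqueAround G A D) (c : ι) (hHD : H ⊆ D)
    (hH : (G.induce H).Connected) (hAH : ∀ i, Touches G (A i) D → Touches G (A i) H)
    (hK : K ⊆ D \ H) : IsCliqueAround G (Function.update A c H) K := by
  have hKD : K ⊆ D := hK.trans Set.sdiff_subset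
  intro i hi
  by_cases hic : i = c
  · subst hic
    rw [Function.update_self]
    refine ⟨hH, Set.disjoint_left.2 fun x hx hxK => (hK hxK).2 hx, fun j hj hjK => ?_⟩
    rw [Function.update_of_ne hj] at hjK ⊢
    have hjD := hjK.mono subset_rfl hKD
    exact ⟨((hA j hjD).2.1.mono_right hHD).symm, (hAH j hjD).symm⟩
  · rw [Function.update_of_ne hic] at hi ⊢
    have hiD := hi.mono subset_rfl hKD
    refine ⟨(hA i hiD).1, (hA i hiD).2.1.mono_right hKD, fun j hj hjK => ?_⟩
    by_cases hjc : j = c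
    · subst hjc
      rw [Function.update_self]
      exact ⟨(hA i hiD).2.1.mono_right hHD, hAH i hiD⟩
    · rw [Function.update_of_ne hjc] at hjK ⊢
      exact (hA i hiD).2.2 j hj (hjK.mono subset_rfl hKD)

lemma HasColoringAvoiding.of_diff {V ι : Type*} [DecidableEq ι] {G : SimpleGraph V} {C : ℕ}
    {A : ι → Set V} {D H : Set V} {c : ι} (hc : ¬ Touches G (A c) D) (b : V → Bool)
    (hb : ∀ S ⊆ H, (G.induce S).Connected → (∀ x ∈ S, ∀ y ∈ S, b x = b y) → S.ncard ≤ C)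
    (h : HasColoringAvoiding G C (Function.update A c H) (D \ H)) :
    HasColoringAvoiding G C A D := by
  classical
  obtain ⟨f, hf₁, hf₂⟩ := h
  let g (x : V) : ι × Bool := if x ∈ H then (c, b x) else f x
  have hgH (x : V) (hx : x ∈ H) : g x = (c, b x) := if_pos hx
  have hgf (x : V) (hx : x ∉ H) : g x = f x := if_neg hx
  refine ⟨g, ?_, ?_⟩
  · rintro v hv i ⟨u, hu, huv⟩
    have hic : i ≠ c := by
      rintro rfl
      exact hc ⟨u, hu, v, hv, huv⟩
    by_cases hvH : v ∈ H
    · rw [hgH v hvH]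
      exact hic.symm
    · rw [hgf v hvH]
      exact hf₁ v ⟨hv, hvH⟩ i ⟨u, by rwa [Function.update_of_ne hic], huv⟩
  · intro S hSD hS hmono
    by_cases hSH : ∃ s ∈ S, s ∈ H
    · obtain ⟨s, hs, hsH⟩ := hSH
      have hstep : ∀ x ∈ S, ∀ y ∈ S, G.Adj x y → x ∈ H → y ∈ H := by
        intro x hx y hy hxy hxH
        by_contra hyH
        refine hf₁ y ⟨hSD hy, hyH⟩ c ⟨x, by rwa [Function.update_self], hxy⟩ ?_
        rw [← hgf y hyH, ← hmono x hx y hy, hgH x hxH]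
      have hsub : S ⊆ H := by
        intro x hx
        have := eq_of_induce_preconnected hS.preconnected (· ∈ H)
          (fun y hy z hz hyz => propext ⟨hstep y hy z hz hyz, hstep z hz y hy hyz.symm⟩) hs hx
        exact this.mp hsH
      refine hb S hsub hS fun x hx y hy => ?_
      have := hmono x hx y hy
      rw [hgH x (hsub hx), hgH y (hsub hy)] at this
      exact congrArg Prod.snd this
    · push Not at hSH
      refine hf₂ S (fun x hx => ⟨hSD hx, hSH x hx⟩) hS fun x hx y hy => ?_
      rw [← hgf x (hSH x hx), ← hgf y (hSH y hy)]
      exact hmono x hx y hy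

lemma IsCliqueAround.hasColoringAvoiding {V : Type*} [Finite V] {G : SimpleGraph V} {t : ℕ}
    [Nonempty (Fin t)] (hG : ¬ IsMinorOf (⊤ : SimpleGraph (Fin (t + 1))) G)
    {A : Fin t → Set V} {D : Set V} (hA : IsCliqueAround G A D) (hD : (G.induce D).Connected) :
    HasColoringAvoiding G t A D := by
  induction hn : D.ncard using Nat.strong_induction_on generalizing A D with
  | _ n ih =>
  obtain ⟨c, hc⟩ := hA.exists_not_touches hD hG
  have hex : ∀ i, ∃ v ∈ D, Touches G (A i) D → ∃ u ∈ A i, G.Adj u v := by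
    intro i
    by_cases hi : Touches G (A i) D
    · obtain ⟨u, hu, v, hv, huv⟩ := hi
      exact ⟨v, hv, fun _ => ⟨u, hu, huv⟩⟩
    · obtain ⟨v⟩ := hD.nonempty
      exact ⟨v, v.2, fun h => absurd h hi⟩
  choose v hvD hv using hex
  obtain ⟨H, hHD, hvH, hH, b, hb⟩ := exists_connected_two_coloring hD v hvD
  rw [Fintype.card_fin] at hb
  refine .of_diff hc b hb (.of_connected fun K hK hKconn => ?_)
  refine ih K.ncard ?_ (hA.update c hHD hH ?_ hK) hKconn rfl
  · rw [← hn]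
    refine Set.ncard_lt_ncard (Set.ssubset_iff_of_subset (hK.trans Set.sdiff_subset) |>.2 ?_)
      (Set.toFinite D)
    exact ⟨v c, hvD c, fun h => (hK h).2 (hvH c)⟩
  · intro i hi
    obtain ⟨u, hu, huv⟩ := hv i hi
    exact ⟨u, hu, v i, hvH i, huv⟩

/-- for every `t ≥ 1` there is `C ≥ 1` such that every finite graph with no
`K_{t+1}` minor admits a `2t`-coloring with clustering `C`. -/
theorem stmt7 (t : ℕ) (ht : 1 ≤ t) :
    ∃ C : ℕ, 1 ≤ C ∧ ∀ (V : Type) (_ : Fintype V) (G : SimpleGraph V),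
      ¬ IsMinorOf (⊤ : SimpleGraph (Fin (t+1))) G →
      ∃ c : V → Fin (2*t), ClusteredColoring G C c := by
  refine ⟨t, ht, fun V _ G hG => ?_⟩
  have : Nonempty (Fin t) := ⟨⟨0, ht⟩⟩
  obtain ⟨f, -, hf⟩ : HasColoringAvoiding G t (fun _ : Fin t => (∅ : Set V)) Set.univ :=
    .of_connected fun K _ hK =>
      IsCliqueAround.hasColoringAvoiding hG (fun i ⟨_, hx, _⟩ => absurd hx (by simp)) hK
  let e : Fin t × Bool ≃ Fin (2 * t) := Fintype.equivFinOfCardEq (by simp [mul_comm])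
  exact ⟨e ∘ f, fun S hS hmono => hf S (Set.subset_univ S) hS
    fun u hu v hv => e.injective (hmono u hu v hv)⟩
end
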